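/- Let G be a finite non-solvable group. Then every nilpotent maximal subgroup of G has even order. -/

import Mathlib

open Subgroup
open scoped Pointwise commutatorElement

/-- `K` is a normal `p`-complement of `G`: a normal subgroup of order prime to `p` whose quotient
is a `p`-group. -/
structure IsNormalComplement {G : Type*} [Group G] (p : ℕ) (K : Subgroup G) : Prop where
  normal : K.Normal
  not_dvd : ¬ p ∣ Nat.card K
  pow_mem : ∀ g : G, ∃ k : ℕ, g ^ p ^ k ∈ K

/-- `G` is `p`-nilpotent if it has a normal `p`-complement. -/
def IsPNilpotent (p : ℕ) (G : Type*) [Group G] : Prop :=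
  ∃ K : Subgroup G, IsNormalComplement p K

section Basic

variable {G G' : Type*} [Group G] [Group G'] {p : ℕ}

theorem Subgroup.mem_of_pow_mem_of_coprime {K : Subgroup G} {g : G} {m : ℕ}
    (hm : (orderOf g).Coprime m) (h : g ^ m ∈ K) : g ∈ K := by
  obtain ⟨n, hn⟩ := exists_pow_eq_self_of_coprime hm.symm
  rw [← hn]
  exact K.pow_mem h n

theorem Subgroup.mem_of_pow_mem_of_pow_eq_one {K : Subgroup G} {g : G} {m k : ℕ}
    (hm : k.Coprime m) (h1 : g ^ k = 1) (h : g ^ m ∈ K) : g ∈ K :=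
  mem_of_pow_mem_of_coprime (hm.coprime_dvd_left (orderOf_dvd_of_pow_eq_one h1)) h

theorem IsPNilpotent.of_injective (f : G →* G') (hf : Function.Injective f)
    (h : IsPNilpotent p G') : IsPNilpotent p G := by
  obtain ⟨K, hK⟩ := h
  have := hK.normal
  refine ⟨K.comap f, inferInstance, fun hd => hK.not_dvd (hd.trans ?_), fun g => ?_⟩
  · exact card_comap_dvd_of_injective K f hf
  · obtain ⟨k, hk⟩ := hK.pow_mem (f g)
    exact ⟨k, by simpa using hk⟩

theorem IsPNilpotent.mono {H K : Subgroup G} (hHK : H ≤ K) (h : IsPNilpotent p K) :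
    IsPNilpotent p H :=
  h.of_injective (inclusion hHK) (inclusion_injective hHK)

theorem IsPNilpotent.to_subgroup (h : IsPNilpotent p G) (H : Subgroup G) : IsPNilpotent p H :=
  h.of_injective H.subtype H.subtype_injective

theorem isPNilpotent_top : IsPNilpotent p (⊤ : Subgroup G) ↔ IsPNilpotent p G :=
  ⟨fun h => h.of_injective (topEquiv (G := G)).symm.toMonoidHom (topEquiv (G := G)).symm.injective,
    fun h => h.to_subgroup ⊤⟩

theorem IsPNilpotent.of_surjective (f : G →* G') (hf : Function.Surjective f)
    (h : IsPNilpotent p G) : IsPNilpotent p G' := by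
  obtain ⟨K, hK⟩ := h
  refine ⟨K.map f, hK.normal.map f hf, fun hd => hK.not_dvd (hd.trans (card_map_dvd K f)),
    fun g => ?_⟩
  obtain ⟨g, rfl⟩ := hf g
  obtain ⟨k, hk⟩ := hK.pow_mem g
  exact ⟨k, by simpa using mem_map_of_mem f hk⟩

theorem IsPNilpotent.map {H : Subgroup G} (f : G →* G') (h : IsPNilpotent p H) :
    IsPNilpotent p (H.map f) :=
  h.of_surjective (f.subgroupMap H) (f.subgroupMap_surjective H)

theorem IsPNilpotent.of_not_dvd_card (h : ¬ p ∣ Nat.card G) : IsPNilpotent p G :=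
  ⟨⊤, inferInstance, by rwa [card_top], fun _ => ⟨0, trivial⟩⟩

theorem IsNormalComplement.isPGroup_of_eq_bot {K : Subgroup G} (hK : IsNormalComplement p K)
    (h : K = ⊥) : IsPGroup p G := by
  intro g
  obtain ⟨k, hk⟩ := hK.pow_mem g
  rw [h, mem_bot] at hk
  exact ⟨k, hk⟩

variable [hp : Fact p.Prime]

theorem not_dvd_card_iff_forall_orderOf [Finite G] {K : Subgroup G} :
    ¬ p ∣ Nat.card K ↔ ∀ g ∈ K, ¬ p ∣ orderOf g := by
  constructor
  · intro h g hg hd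
    exact h (hd.trans (K.orderOf_dvd_natCard hg))
  · intro h hd
    obtain ⟨x, hx⟩ := exists_prime_orderOf_dvd_card' (G := K) p hd
    exact h x x.2 (by rw [Subgroup.orderOf_coe, hx])

theorem coprime_pow_of_not_dvd {m : ℕ} (h : ¬ p ∣ m) (k : ℕ) : m.Coprime (p ^ k) :=
  (((Nat.Prime.coprime_iff_not_dvd hp.out).2 h).symm).pow_right k

theorem IsNormalComplement.mem_iff [Finite G] {K : Subgroup G} (h : IsNormalComplement p K)
    {g : G} : g ∈ K ↔ ¬ p ∣ orderOf g := by
  refine ⟨not_dvd_card_iff_forall_orderOf.1 h.not_dvd g, fun hg => ?_⟩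
  obtain ⟨k, hk⟩ := h.pow_mem g
  exact mem_of_pow_mem_of_coprime (coprime_pow_of_not_dvd hg k) hk

theorem IsPNilpotent.of_not_dvd_card_ker [Finite G] [Finite G'] (f : G →* G')
    (hf : ¬ p ∣ Nat.card f.ker) (h : IsPNilpotent p G') : IsPNilpotent p G := by
  obtain ⟨K, hK⟩ := h
  have := hK.normal
  refine ⟨K.comap f, inferInstance, fun hd => ?_, fun g => ?_⟩
  · obtain ⟨⟨x, hxK⟩, hx⟩ := exists_prime_orderOf_dvd_card' p hd
    rw [Subgroup.orderOf_mk] at hx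
    have h1 : orderOf (f x) ∣ p := hx ▸ orderOf_map_dvd f x
    rcases (Nat.dvd_prime hp.out).1 h1 with h1 | h1
    · have hk : x ∈ f.ker := orderOf_eq_one_iff.1 h1
      exact hf (hx ▸ f.ker.orderOf_dvd_natCard hk)
    · exact hK.not_dvd (h1 ▸ K.orderOf_dvd_natCard hxK)
  · obtain ⟨k, hk⟩ := hK.pow_mem (f g)
    exact ⟨k, by simpa using hk⟩

theorem IsNormalComplement.normal_map_subtype [Finite G] {N : Subgroup G} [N.Normal]
    {K : Subgroup N} (hK : IsNormalComplement p K) : (K.map N.subtype).Normal := by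
  have hmem : ∀ g, g ∈ K.map N.subtype ↔ g ∈ N ∧ ¬ p ∣ orderOf g := by
    intro g
    constructor
    · rintro ⟨g, hg, rfl⟩
      exact ⟨g.2, by simpa using hK.mem_iff.1 hg⟩
    · rintro ⟨hg, ho⟩
      exact ⟨⟨g, hg⟩, hK.mem_iff.2 (by simpa using ho), rfl⟩
  refine ⟨fun n hn g => ?_⟩
  rw [hmem] at hn ⊢
  refine ⟨Normal.conj_mem ‹_› n hn.1 g, ?_⟩
  have : orderOf (g * n * g⁻¹) = orderOf n := by
    simpa using (MulAut.conj g).orderOf_eq n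
  rw [this]
  exact hn.2

theorem IsPNilpotent.of_normal [Finite G] {N : Subgroup G} [N.Normal]
    (hN : ∀ g : G, ∃ k : ℕ, g ^ p ^ k ∈ N) (h : IsPNilpotent p N) : IsPNilpotent p G := by
  obtain ⟨K, hK⟩ := h
  refine ⟨K.map N.subtype, hK.normal_map_subtype,
    fun hd => hK.not_dvd (hd.trans (card_map_dvd K _)), fun g => ?_⟩
  obtain ⟨k, hk⟩ := hN g
  obtain ⟨l, hl⟩ := hK.pow_mem ⟨_, hk⟩
  refine ⟨k + l, ?_⟩
  rw [pow_add, pow_mul]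
  exact ⟨_, hl, rfl⟩

theorem IsPGroup.isPNilpotent (h : IsPGroup p G) : IsPNilpotent p G :=
  ⟨⊥, inferInstance, by simpa using hp.out.ne_one, fun g => by simpa using h g⟩

theorem IsNormalComplement.sup_sylow [Finite G] {K : Subgroup G} (h : IsNormalComplement p K)
    (P : Sylow p G) : K ⊔ P = ⊤ := by
  have := h.normal
  have hq : IsPGroup p (G ⧸ K) := by
    intro g
    obtain ⟨g, rfl⟩ := QuotientGroup.mk_surjective g
    obtain ⟨k, hk⟩ := h.pow_mem g
    exact ⟨k, by rwa [← QuotientGroup.mk_pow, QuotientGroup.eq_one_iff]⟩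
  obtain ⟨n, hn⟩ := IsPGroup.iff_card.1 hq
  rw [← index_eq_card] at hn
  rw [← index_eq_one]
  have h1 : (K ⊔ P).index ∣ p ^ n := hn ▸ index_dvd_of_le le_sup_left
  have h2 : (K ⊔ P).index ∣ (P : Subgroup G).index := index_dvd_of_le le_sup_right
  exact Nat.eq_one_of_dvd_coprimes (coprime_pow_of_not_dvd P.not_dvd_index n).symm h1 h2

theorem IsNormalComplement.exists_smul_eq [Finite G] {K : Subgroup G}
    (h : IsNormalComplement p K) (P Q : Sylow p G) : ∃ y ∈ K, y • P = Q := by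
  have := h.normal
  obtain ⟨g, rfl⟩ := MulAction.exists_smul_eq G P Q
  have hg : g ∈ K ⊔ P := h.sup_sylow P ▸ mem_top g
  obtain ⟨y, hy, s, hs, rfl⟩ := mem_sup_of_normal_left.1 hg
  refine ⟨y, hy, ?_⟩
  rw [mul_smul, Sylow.smul_eq_iff_mem_normalizer.2 (le_normalizer hs)]

theorem IsPGroup.eq_one_of_not_dvd {H : Subgroup G} (hH : IsPGroup p H) {g : G} (hg : g ∈ H)
    (h : ¬ p ∣ orderOf g) : g = 1 := by
  by_contra hne
  exact h (by simpa using hH.dvd_orderOf (g := ⟨g, hg⟩) (by simpa using hne))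

theorem IsPGroup.disjoint_of_not_dvd [Finite G] {H K : Subgroup G} (hH : IsPGroup p H)
    (hK : ¬ p ∣ Nat.card K) : H ⊓ K = ⊥ := by
  rw [eq_bot_iff]
  rintro g ⟨h1, h2⟩
  exact hH.eq_one_of_not_dvd h1 (not_dvd_card_iff_forall_orderOf.1 hK g h2)

theorem isPGroup_of_forall_not_dvd [Finite G]
    (h : ∀ g : G, ¬ p ∣ orderOf g → g = 1) : IsPGroup p G := by
  intro g
  obtain ⟨k, m, hm, ho⟩ := Nat.exists_eq_pow_mul_and_not_dvd (orderOf_pos g).ne' p hp.out.ne_one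
  refine ⟨k, h _ ?_⟩
  rw [orderOf_pow, ho, Nat.gcd_eq_right (dvd_mul_right _ _),
    Nat.mul_div_cancel_left _ (pow_pos hp.out.pos k)]
  exact hm

theorem IsPGroup.exists_normalizer_notMem [Finite G] {P R : Subgroup G} (hP : IsPGroup p P)
    (hRP : R < P) : ∃ x ∈ P, x ∉ R ∧ x ∈ normalizer (R : Set G) := by
  have := hP.isNilpotent
  have hlt : R.subgroupOf P < ⊤ := by
    rw [lt_top_iff_ne_top, Ne, subgroupOf_eq_top]
    exact hRP.not_ge
  have h := Group.normalizerCondition_of_isNilpotent (G := P) _ hlt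
  rw [← subgroupOf_normalizer_eq hRP.le] at h
  obtain ⟨x, hx, hxR⟩ := SetLike.exists_of_lt h
  exact ⟨x, x.2, hxR, hx⟩

end Basic

theorem commute_of_sq_eq_zero {R : Type*} [Ring R] {n y : R} (hn : n * n = 0)
    (h2 : ∀ r : R, 2 * r = 0 → r = 0) {m : ℕ} (hm : ∀ r : R, m * r = 0 → r = 0)
    (hym : y ^ m = 1)
    (h₁ : Commute y ((1 + n) * y * (1 - n)))
    (h₂ : Commute y ((1 + n) * ((1 + n) * y * (1 - n)) * (1 - n))) : Commute n y := by
  have e₁ : y * (n * y - y * n) - (n * y - y * n) * y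
      = y * (n * y * n) - (n * y * n) * y := by
    have := h₁.eq
    rw [← sub_eq_zero] at this ⊢
    rw [← this]
    noncomm_ring
  have e₂ : 2 * (y * (n * y - y * n) - (n * y - y * n) * y)
      = 4 * (y * (n * y * n) - (n * y * n) * y) := by
    have hx : (1 + n) * ((1 + n) * y * (1 - n)) * (1 - n) = y + 2 * (n * y - y * n)
        - 4 * (n * y * n) := by
      have : (1 + n) * ((1 + n) * y * (1 - n)) * (1 - n) = y + 2 * (n * y - y * n)
        - 4 * (n * y * n) + (n * n) * y * (1 - n) * (1 - n) + (1 + 2 * n) * y * (n * n) := by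
        noncomm_ring
      rw [this, hn]
      simp
    have := h₂.eq
    rw [hx] at this
    rw [← sub_eq_zero] at this ⊢
    rw [← this]
    noncomm_ring
  have e₃ : y * (n * y - y * n) = (n * y - y * n) * y := by
    rw [← sub_eq_zero]
    apply h2
    rw [← e₁] at e₂
    set c := y * (n * y - y * n) - (n * y - y * n) * y
    have : (4 : R) * c - 2 * c = 0 := by rw [← e₂, sub_self]
    rw [← this]
    noncomm_ring
  have hk : ∀ k : ℕ, (n * y ^ k - y ^ k * n) * y = k * (y ^ k * (n * y - y * n)) := by
    intro k
    induction k with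
    | zero => simp
    | succ k ih =>
      have : (n * y ^ (k + 1) - y ^ (k + 1) * n) * y
          = ((n * y ^ k - y ^ k * n) * y) * y + y ^ k * ((n * y - y * n) * y) := by
        rw [pow_succ]
        noncomm_ring
      rw [this, ih, ← e₃]
      have h' : (k * (y ^ k * (n * y - y * n))) * y = k * (y ^ k * ((n * y - y * n) * y)) := by
        noncomm_ring
      rw [h', ← e₃, pow_succ]
      push_cast
      noncomm_ring
  have h := hk m
  rw [hym] at h
  simp only [mul_one, one_mul, sub_self, zero_mul] at h
  exact sub_eq_zero.1 (hm _ h.symm)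

theorem IsPNilpotent.normalizer_of_map {G G' : Type*} [Group G] [Group G'] {p : ℕ} (f : G →* G')
    (hf : Function.Injective f) {U : Subgroup G}
    (h : IsPNilpotent p (normalizer ((U.map f : Subgroup G') : Set G'))) :
    IsPNilpotent p (normalizer (U : Set G)) := by
  refine h.of_injective ((f.comp (normalizer (U : Set G)).subtype).codRestrict _
    fun x => le_normalizer_map f ⟨x, x.2, rfl⟩) fun a b hab => ?_
  exact Subtype.ext (hf (congrArg Subtype.val hab))

theorem IsPGroup.commutator_lt {G : Type*} [Group G] [Finite G] {p : ℕ} [Fact p.Prime]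
    {P : Subgroup G} (hP : IsPGroup p P) (hbot : P ≠ ⊥) : ⁅P, P⁆ < P := by
  have := hP.isNilpotent
  have := P.nontrivial_iff_ne_bot.2 hbot
  refine lt_of_le_of_ne (commutator_le_self P) fun he => ?_
  rw [← map_subtype_commutator] at he
  refine (Group.IsSolvable.commutator_lt_top_of_nontrivial P).ne ?_
  apply map_injective P.subtype_injective
  rw [he, ← MonoidHom.range_eq_map, range_subtype]

section Frobenius

variable {G : Type*} [Group G] [Finite G] {p : ℕ} [hp : Fact p.Prime]

theorem IsNormalComplement.commute_of_normal {N K : Subgroup G}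
    (h : IsNormalComplement p K) [N.Normal] (hN : IsPGroup p N) {x y : G} (hx : x ∈ N)
    (hy : y ∈ K) : Commute x y := by
  have := h.normal
  exact commute_of_normal_of_disjoint N K inferInstance inferInstance
    (disjoint_iff.2 (hN.disjoint_of_not_dvd h.not_dvd)) x y hx hy

/-- If all normalizers of nontrivial `p`-subgroups are `p`-nilpotent, then two Sylow `p`-subgroups
are conjugate by an element centralizing their intersection. -/
theorem exists_mem_centralizer_smul_eq
    (h : ∀ U : Subgroup G, U ≠ ⊥ → IsPGroup p U → IsPNilpotent p (normalizer (U : Set G)))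
    (P Q : Sylow p G) : ∃ c ∈ centralizer ((P ⊓ Q : Subgroup G) : Set G), c • P = Q := by
  induction hn : Nat.card G - Nat.card (P ⊓ Q : Subgroup G) using Nat.strong_induction_on
    generalizing P Q with
  | _ n ih =>
  subst hn
  have step : ∀ P' Q' : Sylow p G, (P ⊓ Q : Subgroup G) < (P' ⊓ Q' : Subgroup G) →
      ∃ c ∈ centralizer ((P' ⊓ Q' : Subgroup G) : Set G), c • P' = Q' := by
    intro P' Q' hlt
    refine ih _ ?_ P' Q' rfl
    have h1 : Nat.card (P ⊓ Q : Subgroup G) < Nat.card (P' ⊓ Q' : Subgroup G) :=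
      Set.Finite.card_lt_card (Set.toFinite _) hlt
    have h2 : Nat.card (P' ⊓ Q' : Subgroup G) ≤ Nat.card G :=
      Nat.le_of_dvd Nat.card_pos (card_subgroup_dvd_card _)
    omega
  by_cases hbot : (P ⊓ Q : Subgroup G) = ⊥
  · obtain ⟨g, hg⟩ := MulAction.exists_smul_eq G P Q
    refine ⟨g, ?_, hg⟩
    rw [mem_centralizer_iff]
    intro x hx
    have : x ∈ (P ⊓ Q : Subgroup G) := hx
    rw [hbot, mem_bot] at this
    simp [this]
  by_cases hPQ : P = Q
  · exact ⟨1, one_mem _, by simp [hPQ]⟩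
  set D : Subgroup G := P ⊓ Q with hD
  have hDP : D < P := by
    refine lt_of_le_of_ne inf_le_left fun he => hPQ ?_
    have : (P : Subgroup G) ≤ Q := inf_eq_left.1 he
    exact (Sylow.ext (P.3 Q.2 this)).symm
  have hDQ : D < Q := by
    refine lt_of_le_of_ne inf_le_right fun he => hPQ ?_
    have : (Q : Subgroup G) ≤ P := inf_eq_right.1 he
    exact (Sylow.ext (Q.3 P.2 this))
  obtain ⟨s, hsP, hsD, hsN⟩ := P.2.exists_normalizer_notMem hDP
  obtain ⟨t, htQ, htD, htN⟩ := Q.2.exists_normalizer_notMem hDQ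
  have hYN := h D hbot (P.2.to_le inf_le_left)
  set N := normalizer (D : Set G) with hN
  obtain ⟨Y, hY⟩ := hYN
  have hSp : IsPGroup p ((P : Subgroup G).subgroupOf N) := P.2.comap_subtype
  have hTp : IsPGroup p ((Q : Subgroup G).subgroupOf N) := Q.2.comap_subtype
  obtain ⟨S, hS⟩ := hSp.exists_le_sylow
  obtain ⟨T, hT⟩ := hTp.exists_le_sylow
  obtain ⟨y, hyY, hy⟩ := hY.exists_smul_eq S T
  have hyC : ∀ d ∈ D, d * y = y * d := by
    intro d hd
    have : (D.subgroupOf N).Normal := normal_in_normalizer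
    have hc := hY.commute_of_normal (N := D.subgroupOf N)
      (P.2.to_le inf_le_left : IsPGroup p D).comap_subtype
      (x := ⟨d, le_normalizer hd⟩) (y := y) hd hyY
    exact congrArg Subtype.val hc.eq
  obtain ⟨P₁, hP₁⟩ := (S.2.map N.subtype).exists_le_sylow
  have hDN : D ≤ N := le_normalizer
  have hDP₁ : ∀ d ∈ D, d ∈ P₁ := fun d hd =>
    hP₁ ⟨⟨d, hDN hd⟩, hS (mem_subgroupOf.2 (hDP.le hd)), rfl⟩
  obtain ⟨c₁, hc₁, hcP₁⟩ := step P P₁ (by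
    refine lt_of_le_of_ne (le_inf inf_le_left hDP₁) fun he => hsD ?_
    rw [he]
    exact ⟨hsP, hP₁ ⟨⟨s, hsN⟩, hS (mem_subgroupOf.2 hsP), rfl⟩⟩)
  have htP₁ : ∀ u ∈ Q, u ∈ N → u ∈ (y : G) • P₁ := by
    intro u hu huN
    have hu' : (⟨u, huN⟩ : N) ∈ y • S := by
      rw [hy]
      exact hT (mem_subgroupOf.2 hu)
    rw [← SetLike.mem_coe, Sylow.coe_smul, Set.mem_smul_set_iff_inv_smul_mem] at hu' ⊢
    exact hP₁ ⟨_, hu', rfl⟩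
  obtain ⟨c₂, hc₂, hcQ⟩ := step ((y : G) • P₁) Q (by
    refine lt_of_le_of_ne
      (le_inf (fun d hd => htP₁ d (hDQ.le hd) (hDN hd)) inf_le_right) fun he => htD ?_
    rw [he]
    exact ⟨htP₁ t htQ htN, htQ⟩)
  refine ⟨c₂ * y * c₁, ?_, by rw [mul_smul, mul_smul, hcP₁, hcQ]⟩
  refine mul_mem (mul_mem ?_ ?_) ?_
  · exact mem_centralizer_iff.2 fun d hd => mem_centralizer_iff.1 hc₂ d
      (mem_inf.2 ⟨htP₁ d hd.2 (hDN hd), hd.2⟩)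
  · exact mem_centralizer_iff.2 hyC
  · exact mem_centralizer_iff.2 fun d hd => mem_centralizer_iff.1 hc₁ d
      (mem_inf.2 ⟨hd.1, hDP₁ d hd⟩)

/-- A normal subgroup of `p`-power index which is proper, when `P` controls its own fusion. -/
theorem exists_normal_lt_top
    (h : ∀ U : Subgroup G, U ≠ ⊥ → IsPGroup p U → IsPNilpotent p (normalizer (U : Set G)))
    (hpG : p ∣ Nat.card G) :
    ∃ N : Subgroup G, N.Normal ∧ N < ⊤ ∧ ∀ g : G, ∃ k : ℕ, g ^ p ^ k ∈ N := by
  obtain ⟨P⟩ : Nonempty (Sylow p G) := inferInstance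
  have hPbot : (P : Subgroup G) ≠ ⊥ := P.ne_bot_of_dvd_card hpG
  have hYN := h P hPbot P.2
  set N := normalizer ((P : Subgroup G) : Set G) with hN
  obtain ⟨Y, hY⟩ := hYN
  have hPN : (P : Subgroup G) ≤ N := le_normalizer
  have hfoc : focalSubgroup (P : Subgroup G) ≤ ⁅(P : Subgroup G), (P : Subgroup G)⁆ := by
    rw [focalSubgroup_def, closure_le]
    rintro _ ⟨hg, x, hx, u, rfl⟩
    have hx' : u * x⁻¹ * u⁻¹ ∈ P := by
      have := mul_mem (inv_mem hx) hg
      rwa [commutatorElement_def, show x⁻¹ * (x * u * x⁻¹ * u⁻¹) = u * x⁻¹ * u⁻¹ by group] at this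
    have hx'' : u * x⁻¹ * u⁻¹ ∈ (u • P : Sylow p G) := by
      rw [← SetLike.mem_coe, Sylow.coe_smul, Set.mem_smul_set_iff_inv_smul_mem]
      have hxP : x ∈ P := hx
      simpa [← mul_assoc] using hxP
    obtain ⟨c, hc, hcP⟩ := exists_mem_centralizer_smul_eq h (u • P) P
    have hcx := mem_centralizer_iff.1 hc _ ⟨hx'', hx'⟩
    have hn : c * u ∈ N := by
      rw [← mul_smul] at hcP
      exact Sylow.smul_eq_iff_mem_normalizer.1 hcP
    have hconj : u * x⁻¹ * u⁻¹ = (c * u) * x⁻¹ * (c * u)⁻¹ := by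
      calc u * x⁻¹ * u⁻¹ = (u * x⁻¹ * u⁻¹ * c) * c⁻¹ := by group
        _ = _ := by rw [hcx]; group
    have hmem : (⟨c * u, hn⟩ : N) ∈ Y ⊔ P.subtype hPN := hY.sup_sylow (P.subtype hPN) ▸ mem_top _
    have := hY.normal
    obtain ⟨y, hy, s, hs, hys⟩ := mem_sup_of_normal_right.1 (sup_comm Y _ ▸ hmem)
    have hy' : (y : G) ∈ P := hy
    have hsC : ∀ d ∈ P, d * (s : G) = s * d := by
      intro d hd
      have : ((P : Subgroup G).subgroupOf N).Normal := normal_in_normalizer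
      have hc := hY.commute_of_normal (N := (P : Subgroup G).subgroupOf N) P.2.comap_subtype
        (x := ⟨d, hPN hd⟩) (y := s) hd hs
      exact congrArg Subtype.val hc.eq
    have hcu : c * u = y * s := (congrArg Subtype.val hys).symm
    have : ⁅x, u⁆ = ⁅x, (y : G)⁆ := by
      have e1 : ⁅x, u⁆ = x * (u * x⁻¹ * u⁻¹) := by rw [commutatorElement_def]; group
      rw [e1, hconj, hcu]
      calc x * (y * s * x⁻¹ * (y * s : G)⁻¹)
          = x * y * (s * x⁻¹) * (s : G)⁻¹ * (y : G)⁻¹ := by rw [mul_inv_rev]; simp only [mul_assoc]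
        _ = _ := by
          rw [← hsC _ (inv_mem hx), commutatorElement_def]
          simp only [mul_assoc, mul_inv_cancel_left]
    rw [this]
    exact commutator_mem_commutator hx hy'
  have hlt : focalSubgroup (P : Subgroup G) < P := by
    exact lt_of_le_of_lt hfoc (P.2.commutator_lt hPbot)
  refine ⟨(P : Subgroup G).transferFocal.ker, inferInstance, ?_, fun g => ?_⟩
  · rw [lt_top_iff_ne_top]
    intro he
    have := ker_transferFocal_inf_eq_focalSubgroup P
    rw [he, top_inf_eq] at this
    exact hlt.ne this.symm
  · obtain ⟨k, hk⟩ := (P.2.to_quotient (focalSubgroupOf (P : Subgroup G)))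
      ((P : Subgroup G).transferFocal g)
    exact ⟨k, by rw [MonoidHom.mem_ker, map_pow, hk]⟩

end Frobenius

/-- **Frobenius' normal `p`-complement theorem**. -/
theorem isPNilpotent_of_forall_normalizer {p : ℕ} [Fact p.Prime] {G : Type*} [Group G] [Finite G]
    (h : ∀ U : Subgroup G, U ≠ ⊥ → IsPGroup p U → IsPNilpotent p (normalizer (U : Set G))) :
    IsPNilpotent p G := by
  induction hn : Nat.card G using Nat.strong_induction_on generalizing G with
  | _ n ih =>
  subst hn
  by_cases hpG : p ∣ Nat.card G
  · obtain ⟨N, hN, hlt, hpow⟩ := exists_normal_lt_top h hpG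
    refine IsPNilpotent.of_normal hpow (ih _ ?_ (fun U hU hUp => ?_) rfl)
    · simpa using Set.Finite.card_lt_card (Set.toFinite _) hlt
    · have h1 := h (U.map N.subtype)
          (by rwa [Ne, map_eq_bot_iff_of_injective _ N.subtype_injective]) (hUp.map _)
      exact h1.normalizer_of_map N.subtype N.subtype_injective
  · exact IsPNilpotent.of_not_dvd_card hpG

section QuadraticAction

variable {G G' : Type*} [Group G] [Group G']

/-- The element `x` acts quadratically on `A`: the group `⟨A, x⟩` has class at most two, up to
the commutativity of `A`. -/
def ActsQuadratically (A : Subgroup G) (x : G) : Prop :=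
  ∀ a ∈ A, Commute ⁅a, x⁆ x ∧ ∀ b ∈ A, Commute ⁅a, x⁆ b

theorem ActsQuadratically.mono {A B : Subgroup G} {x : G} (h : ActsQuadratically B x)
    (hAB : A ≤ B) : ActsQuadratically A x :=
  fun a ha => ⟨(h a (hAB ha)).1, fun b hb => (h a (hAB ha)).2 b (hAB hb)⟩

/-- The abelian subgroups `A` of `P` centralized by every element of `P` acting quadratically
on `A`. -/
structure IsQuadraticallyClosed (P A : Subgroup G) : Prop where
  le : A ≤ P
  commute : ∀ a ∈ A, ∀ b ∈ A, Commute a b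
  commute_of_quadratic : ∀ x ∈ P, ActsQuadratically A x → ∀ a ∈ A, Commute a x

/-- The Glauberman–Solomon subgroup `D*(P)`. -/
def dstar (P : Subgroup G) : Subgroup G :=
  sSup {A | IsQuadraticallyClosed P A}

theorem actsQuadratically_of_normalizes {A B : Subgroup G} (hA : ∀ a ∈ A, ∀ b ∈ A, Commute a b)
    (hB : ∀ a ∈ B, ∀ b ∈ B, Commute a b) (hAB : A ≤ normalizer (B : Set G))
    (hBA : B ≤ normalizer (A : Set G)) {x : G} (hx : x ∈ B) : ActsQuadratically A x := by
  intro a ha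
  have h1 : ⁅a, x⁆ ∈ B := le_normalizer_iff_commutator_le_right.1 hAB
    (commutator_mem_commutator ha hx)
  have h2 : ⁅a, x⁆ ∈ A := le_normalizer_iff_commutator_le_left.1 hBA
    (commutator_mem_commutator ha hx)
  exact ⟨hB _ h1 _ hx, fun b hb => hA _ h2 _ hb⟩

theorem commute_of_mem_sup {A B : Subgroup G} {x : G} (hA : ∀ a ∈ A, Commute a x)
    (hB : ∀ b ∈ B, Commute b x) : ∀ c ∈ A ⊔ B, Commute c x := by
  have h : A ⊔ B ≤ centralizer {x} :=
    sup_le (fun a ha => mem_centralizer_singleton_iff.2 (hA a ha))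
      fun b hb => mem_centralizer_singleton_iff.2 (hB b hb)
  exact fun c hc => mem_centralizer_singleton_iff.1 (h hc)

theorem IsQuadraticallyClosed.sup {P A B : Subgroup G} (hA : IsQuadraticallyClosed P A)
    (hB : IsQuadraticallyClosed P B) (hAB : A ≤ normalizer (B : Set G))
    (hBA : B ≤ normalizer (A : Set G)) : IsQuadraticallyClosed P (A ⊔ B) := by
  have hcomm : ∀ b ∈ B, ∀ a ∈ A, Commute a b := fun b hb =>
    hA.commute_of_quadratic b (hB.le hb)
      (actsQuadratically_of_normalizes hA.commute hB.commute hAB hBA hb)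
  refine ⟨sup_le hA.le hB.le, fun a ha => ?_, fun x hx h => ?_⟩
  · intro b hb
    refine commute_of_mem_sup (fun c hc => ?_) (fun c hc => ?_) a ha
    · exact (commute_of_mem_sup (fun d hd => hA.commute d hd c hc)
        (fun d hd => (hcomm d hd c hc).symm) b hb).symm
    · exact (commute_of_mem_sup (fun d hd => hcomm c hc d hd)
        (fun d hd => hB.commute d hd c hc) b hb).symm
  · exact commute_of_mem_sup (hA.commute_of_quadratic x hx (h.mono le_sup_left))
      (hB.commute_of_quadratic x hx (h.mono le_sup_right))

theorem commute_map_iff_of_injOn {P : Subgroup G} {f : G →* G'} (hf : Set.InjOn f P) {a b : G}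
    (ha : a ∈ P) (hb : b ∈ P) : Commute (f a) (f b) ↔ Commute a b := by
  refine ⟨fun h => hf (mul_mem ha hb) (mul_mem hb ha) ?_, fun h => h.map f⟩
  simpa using h.eq

theorem actsQuadratically_map_iff {P A : Subgroup G} {f : G →* G'} (hf : Set.InjOn f P)
    (hA : A ≤ P) {x : G} (hx : x ∈ P) :
    ActsQuadratically (A.map f) (f x) ↔ ActsQuadratically A x := by
  have hc : ∀ a ∈ A, ⁅a, x⁆ ∈ P := fun a ha =>
    (commutator_le_self P) (commutator_mem_commutator (hA ha) hx)
  constructor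
  · intro h a ha
    obtain ⟨h1, h2⟩ := h (f a) (mem_map_of_mem f ha)
    rw [← map_commutatorElement] at h1 h2
    exact ⟨(commute_map_iff_of_injOn hf (hc a ha) hx).1 h1, fun b hb =>
      (commute_map_iff_of_injOn hf (hc a ha) (hA hb)).1 (h2 _ (mem_map_of_mem f hb))⟩
  · rintro h _ ⟨a, ha, rfl⟩
    obtain ⟨h1, h2⟩ := h a ha
    rw [← map_commutatorElement]
    refine ⟨h1.map f, ?_⟩
    rintro _ ⟨b, hb, rfl⟩
    exact (h2 b hb).map f

theorem isQuadraticallyClosed_map_iff {P A : Subgroup G} {f : G →* G'} (hf : Set.InjOn f P)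
    (hA : A ≤ P) :
    IsQuadraticallyClosed (P.map f) (A.map f) ↔ IsQuadraticallyClosed P A := by
  constructor
  · intro h
    refine ⟨hA, fun a ha b hb => ?_, fun x hx hq a ha => ?_⟩
    · exact (commute_map_iff_of_injOn hf (hA ha) (hA hb)).1
        (h.commute _ (mem_map_of_mem f ha) _ (mem_map_of_mem f hb))
    · exact (commute_map_iff_of_injOn hf (hA ha) hx).1 (h.commute_of_quadratic _
        (mem_map_of_mem f hx)
        ((actsQuadratically_map_iff hf hA hx).2 hq) _ (mem_map_of_mem f ha))
  · intro h
    refine ⟨map_mono hA, ?_, ?_⟩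
    · rintro _ ⟨a, ha, rfl⟩ _ ⟨b, hb, rfl⟩
      exact (h.commute a ha b hb).map f
    · rintro _ ⟨x, hx, rfl⟩ hq _ ⟨a, ha, rfl⟩
      exact (h.commute_of_quadratic x hx ((actsQuadratically_map_iff hf hA hx).1 hq) a ha).map f

theorem IsQuadraticallyClosed.le_dstar {P A : Subgroup G} (hA : IsQuadraticallyClosed P A) :
    A ≤ dstar P :=
  le_sSup hA

variable [Finite G] {p : ℕ} [Fact p.Prime]

theorem normalizes_of_maximal {P A : Subgroup G} (hP : IsPGroup p P)
    (hA : Maximal (IsQuadraticallyClosed P) A) : P ≤ normalizer (A : Set G) := by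
  by_contra hnot
  set R := P ⊓ normalizer (A : Set G) with hR
  have hAR : A ≤ R := le_inf hA.prop.le le_normalizer
  obtain ⟨x, hxP, hxR, hxN⟩ := hP.exists_normalizer_notMem (R := R)
    (lt_of_le_of_ne inf_le_left fun h => hnot (inf_eq_left.1 h))
  have hmap : ∀ {S : Subgroup G}, x ∈ normalizer (S : Set G) →
      S.map (MulAut.conj x).toMonoidHom = S := fun h => (mem_normalizer_iff_map_conj_eq.1 h)
  set f := (MulAut.conj x).toMonoidHom
  have hf : Function.Injective f := (MulAut.conj x).injective
  have hPf : P.map f = P := hmap (le_normalizer hxP)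
  have hRf : R.map f = R := hmap hxN
  have hB : IsQuadraticallyClosed P (A.map f) := by
    have := (isQuadraticallyClosed_map_iff (f := f) hf.injOn hA.prop.le).2 hA.prop
    rwa [hPf] at this
  have hBR : A.map f ≤ R := (map_mono hAR).trans hRf.le
  have hAB : A ≤ normalizer ((A.map f : Subgroup G) : Set G) :=
    hAR.trans <| hRf.ge.trans <| (map_mono inf_le_right).trans (le_normalizer_map f)
  have hsup := hA.prop.sup hB hAB (hBR.trans inf_le_right)
  have hle : A.map f ≤ A := le_sup_right.trans (hA.le_of_ge hsup le_sup_left)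
  have heq : A.map f = A := eq_of_le_of_card_ge hle (card_map_of_injective hf).ge
  exact hxR ⟨hxP, mem_normalizer_iff_map_conj_eq.2 heq⟩

theorem isGreatest_dstar {P : Subgroup G} (hP : IsPGroup p P) :
    IsGreatest {A | IsQuadraticallyClosed P A} (dstar P) := by
  have hbot : IsQuadraticallyClosed P ⊥ := by
    refine ⟨bot_le, ?_, ?_⟩ <;> simp +contextual
  obtain ⟨A, -, hA⟩ := Finite.exists_le_maximal hbot
  have hg : IsGreatest {A | IsQuadraticallyClosed P A} A := by
    refine ⟨hA.prop, fun B hB => ?_⟩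
    obtain ⟨C, hBC, hC⟩ := Finite.exists_le_maximal (p := IsQuadraticallyClosed P) hB
    have := hA.prop.sup hC.prop (hA.prop.le.trans (normalizes_of_maximal hP hC))
      (hC.prop.le.trans (normalizes_of_maximal hP hA))
    exact hBC.trans (le_sup_right.trans (hA.le_of_ge this le_sup_left))
  rwa [dstar, hg.isLUB.sSup_eq]

theorem isQuadraticallyClosed_dstar {P : Subgroup G} (hP : IsPGroup p P) :
    IsQuadraticallyClosed P (dstar P) :=
  (isGreatest_dstar hP).1

theorem map_dstar [Finite G'] {P : Subgroup G} (hP : IsPGroup p P) {f : G →* G'}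
    (hf : Set.InjOn f P) : (dstar P).map f = dstar (P.map f) := by
  have hD := isQuadraticallyClosed_dstar hP
  refine le_antisymm ((isQuadraticallyClosed_map_iff hf hD.le).2 hD).le_dstar ?_
  have hB := isQuadraticallyClosed_dstar (hP.map f)
  have heq : (P ⊓ (dstar (P.map f)).comap f).map f = dstar (P.map f) := by
    refine le_antisymm ((map_mono inf_le_right).trans (map_comap_le f _)) fun y hy => ?_
    obtain ⟨x, hx, rfl⟩ := hB.le hy
    exact ⟨x, ⟨hx, hy⟩, rfl⟩
  rw [← heq] at hB ⊢
  exact map_mono ((isQuadraticallyClosed_map_iff hf inf_le_left).1 hB).le_dstar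

theorem normalizer_le_normalizer_dstar {P : Subgroup G} (hP : IsPGroup p P) :
    normalizer (P : Set G) ≤ normalizer (dstar P : Set G) := by
  intro x hx
  rw [mem_normalizer_iff_map_conj_eq] at hx ⊢
  have := map_dstar hP (f := (MulAut.conj x).toMonoidHom) (MulAut.conj x).injective.injOn
  exact this.trans (congrArg dstar hx)

theorem dstar_ne_bot {P : Subgroup G} (hP : IsPGroup p P) (hbot : P ≠ ⊥) : dstar P ≠ ⊥ := by
  have hZ : IsQuadraticallyClosed P ((center P).map P.subtype) := by
    have hc : ∀ x ∈ P, ∀ a ∈ (center P).map P.subtype, Commute a x := by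
      rintro x hx _ ⟨a, ha, rfl⟩
      exact congrArg Subtype.val (mem_center_iff.1 ha ⟨x, hx⟩).symm
    have hle : (center P).map P.subtype ≤ P := map_subtype_le _
    exact ⟨hle, fun a ha b hb => hc b (hle hb) a ha, fun x hx _ => hc x hx⟩
  have := P.nontrivial_iff_ne_bot.2 hbot
  have hn := hP.bot_lt_center
  intro h
  have h1 := hZ.le_dstar
  rw [h, le_bot_iff, map_eq_bot_iff_of_injective _ P.subtype_injective] at h1
  exact hn.ne' h1

end QuadraticAction

theorem IsPGroup.commutator_lt_of_le {G : Type*} [Group G] [Finite G] {p : ℕ} [Fact p.Prime]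
    {U W : Subgroup G} (hU : IsPGroup p U) (hWU : W ≤ U) (hbot : W ≠ ⊥) [W.Normal] :
    ⁅W, U⁆ < W := by
  refine lt_of_le_of_ne (commutator_le_left W U) fun he => hbot ?_
  obtain ⟨n, hn⟩ := (isNilpotent_iff_lowerCentralSeries (S := U)).1 hU.isNilpotent
  have h : ∀ k, W ≤ U.lowerCentralSeries k := by
    intro k
    induction k with
    | zero => exact hWU
    | succ k ih =>
      rw [← he]
      exact commutator_mono ih le_rfl
  exact le_bot_iff.1 (hn ▸ h n)

section Stability

open scoped IsMulCommutative

variable {G : Type*} [Group G]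

/-- The action by conjugation on a commutative normal subgroup, with values in its ring of
endomorphisms. -/
def conjEnd (V : Subgroup G) [V.Normal] [IsMulCommutative V] :
    G →* AddMonoid.End (Additive V) where
  toFun g := (MulAut.conjNormal g : V ≃* V).toMonoidHom.toAdditive
  map_one' := by
    rw [map_one]
    rfl
  map_mul' g h := by
    rw [map_mul]
    rfl

theorem conjEnd_apply {V : Subgroup G} [V.Normal] [IsMulCommutative V] (g : G) (v : Additive V) :
    ((conjEnd V g v).toMul : G) = g * v.toMul * g⁻¹ := rfl

theorem conjEnd_eq_one_iff {V : Subgroup G} [V.Normal] [IsMulCommutative V] {g : G} :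
    conjEnd V g = 1 ↔ g ∈ centralizer (V : Set G) := by
  rw [mem_centralizer_iff]
  constructor
  · intro h v hv
    have h1 := congrArg (fun w => ((w.toMul : V) : G))
      (DFunLike.congr_fun h (Additive.ofMul (⟨v, hv⟩ : V)))
    have h2 : g * v * g⁻¹ = v := h1
    rw [mul_inv_eq_iff_eq_mul] at h2
    exact h2.symm
  · intro h
    refine DFunLike.ext _ _ fun v => ?_
    refine Additive.toMul.injective (Subtype.ext ?_)
    rw [conjEnd_apply, mul_inv_eq_iff_eq_mul]
    exact (h _ v.toMul.2).symm

theorem conjEnd_commute_iff {V : Subgroup G} [V.Normal] [IsMulCommutative V] {g h : G} :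
    Commute (conjEnd V g) (conjEnd V h) ↔ ⁅g, h⁆ ∈ centralizer (V : Set G) := by
  rw [← conjEnd_eq_one_iff, commutatorElement_def, map_mul, map_mul, map_mul]
  have e : ∀ a, conjEnd V a * conjEnd V a⁻¹ = 1 := fun a => by rw [← map_mul]; simp
  have e' : ∀ a, conjEnd V a⁻¹ * conjEnd V a = 1 := fun a => by rw [← map_mul]; simp
  constructor
  · intro hc
    rw [hc.eq, mul_assoc (conjEnd V h), e, mul_one, e]
  · intro hc
    calc conjEnd V g * conjEnd V h
        = conjEnd V g * conjEnd V h * (conjEnd V g⁻¹ * ((conjEnd V h⁻¹ * conjEnd V h))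
          * conjEnd V g) := by rw [e', mul_one, e', mul_one]
      _ = (conjEnd V g * conjEnd V h * conjEnd V g⁻¹ * conjEnd V h⁻¹)
          * (conjEnd V h * conjEnd V g) := by noncomm_ring
      _ = _ := by rw [hc, one_mul]

theorem commutatorElement_mem_centralizer_of_quadratic [Finite G] {p : ℕ} [hp : Fact p.Prime]
    (hp2 : p ≠ 2) {V : Subgroup G} [V.Normal] [IsMulCommutative V] (hV : IsPGroup p V) {x y : G}
    (hx : ∀ v ∈ V, Commute ⁅v, x⁆ x) {m : ℕ} (hm : ¬ p ∣ m)
    (hym : y ^ m ∈ centralizer (V : Set G))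
    (h₁ : ⁅y, x * y * x⁻¹⁆ ∈ centralizer (V : Set G))
    (h₂ : ⁅y, x * (x * y * x⁻¹) * x⁻¹⁆ ∈ centralizer (V : Set G)) :
    ⁅x, y⁆ ∈ centralizer (V : Set G) := by
  set ρ := conjEnd V
  have hn : (ρ x - 1) * (ρ x - 1) = 0 := by
    refine DFunLike.ext _ _ fun v => ?_
    have h := hx _ v.toMul.2
    have h1 : ρ x (ρ x v - v) = ρ x v - v := by
      refine Additive.toMul.injective (Subtype.ext ?_)
      rw [conjEnd_apply, mul_inv_eq_iff_eq_mul]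
      have h' := h.inv_left
      rw [commutatorElement_inv] at h'
      have e : (((ρ x v - v).toMul : V) : G) = ⁅x, (v.toMul : G)⁆ := by
        rw [toMul_sub, Subgroup.coe_div, conjEnd_apply, commutatorElement_def, div_eq_mul_inv]
      rw [e]
      exact h'.symm.eq
    change ρ x (ρ x v - v) - (ρ x v - v) = 0
    rw [h1, sub_self]
  have hx1 : ρ x = 1 + (ρ x - 1) := by abel
  have hx2 : ρ x⁻¹ = 1 - (ρ x - 1) := by
    have e : ρ x⁻¹ * ρ x = 1 := by rw [← map_mul]; simp
    have e2 : ρ x * (1 - (ρ x - 1)) = 1 := by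
      have : ρ x * (1 - (ρ x - 1)) = 1 - (ρ x - 1) * (ρ x - 1) := by
        simp only [mul_sub, sub_mul, mul_one, one_mul]
        abel
      rw [this, hn, sub_zero]
    calc ρ x⁻¹ = ρ x⁻¹ * (ρ x * (1 - (ρ x - 1))) := by rw [e2, mul_one]
      _ = _ := by rw [← mul_assoc, e, one_mul]
  have htors : ∀ k : ℕ, ¬ p ∣ k → ∀ r : AddMonoid.End (Additive V), k * r = 0 → r = 0 := by
    intro k hk r hr
    refine DFunLike.ext _ _ fun v => ?_
    have h1 : (r v).toMul ^ k = 1 := by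
      have := DFunLike.congr_fun hr v
      rw [← nsmul_eq_mul] at this
      exact this
    obtain ⟨n, hn⟩ := hV (r v).toMul
    have h2 : orderOf (r v).toMul = 1 := Nat.eq_one_of_dvd_coprimes (coprime_pow_of_not_dvd hk n)
      (orderOf_dvd_of_pow_eq_one h1) (orderOf_dvd_of_pow_eq_one hn)
    exact orderOf_eq_one_iff.1 h2
  have hp2' : ¬ p ∣ 2 := fun h => hp2 ((Nat.prime_dvd_prime_iff_eq hp.out Nat.prime_two).1 h)
  have hρ : ρ (x * y * x⁻¹) = (1 + (ρ x - 1)) * ρ y * (1 - (ρ x - 1)) := by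
    rw [map_mul, map_mul, ← hx1, ← hx2]
  have hc : Commute (ρ x - 1) (ρ y) := by
    refine commute_of_sq_eq_zero hn (fun r hr => htors 2 hp2' r (by exact_mod_cast hr))
      (htors m hm) ?_ ?_ ?_
    · rw [← map_pow]
      exact conjEnd_eq_one_iff.2 hym
    · rw [← hρ]
      exact conjEnd_commute_iff.2 h₁
    · rw [← hρ, ← hx1, ← hx2, ← map_mul, ← map_mul]
      exact conjEnd_commute_iff.2 h₂
  rw [← conjEnd_commute_iff]
  have := hc.add_left (Commute.one_left (ρ y))
  rwa [sub_add_cancel] at this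

end Stability

section MinimalConfiguration

variable {G : Type*} [Group G]

theorem mem_comap_mk'_centralizer_iff {N U : Subgroup G} [N.Normal] {x : G} :
    x ∈ (centralizer ((U.map (QuotientGroup.mk' N) : Subgroup (G ⧸ N)) : Set (G ⧸ N))).comap
      (QuotientGroup.mk' N) ↔ ∀ u ∈ U, ⁅u, x⁆ ∈ N := by
  rw [mem_comap, mem_centralizer_iff]
  have h : ∀ u, QuotientGroup.mk' N u * QuotientGroup.mk' N x
      = QuotientGroup.mk' N x * QuotientGroup.mk' N u ↔ ⁅u, x⁆ ∈ N := fun u => by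
    rw [← commutatorElement_eq_one_iff_mul_comm, ← map_commutatorElement]
    exact QuotientGroup.eq_one_iff _
  constructor
  · intro hx u hu
    exact (h u).1 (hx _ (mem_map_of_mem _ hu))
  · rintro hx _ ⟨u, hu, rfl⟩
    exact (h u).2 (hx u hu)

/-- The structure of a minimal counterexample to the normal `p`-complement theorem: `U` is the
largest normal `p`-subgroup, and `K / U` an abelian normal `p`-complement of `G / U`. -/
structure MinimalConfiguration (p : ℕ) (P U K : Subgroup G) : Prop where
  isPGroup : IsPGroup p P
  isCoatom : IsCoatom P
  normal : U.Normal
  normal' : K.Normal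
  le : U ≤ P
  le_of_normal : ∀ N : Subgroup G, N.Normal → IsPGroup p N → N ≤ U
  exists_pow : ∃ m, ¬ p ∣ m ∧ ∀ y ∈ K, y ^ m ∈ U
  commutator_le : ⁅K, K⁆ ≤ U
  le_sup : K ⊔ P = ⊤
  centralizer_le : centralizer (U : Set G) ≤ U

namespace MinimalConfiguration

variable {p : ℕ} {P U K : Subgroup G}

theorem mem_of_commutator_mem (h : MinimalConfiguration p P U K) {x : G} (hxP : x ∈ P)
    (hx : ∀ y ∈ K, ⁅y, x⁆ ∈ U) : x ∈ U := by
  have := h.normal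
  have := h.normal'
  set C := (centralizer ((K.map (QuotientGroup.mk' U) : Subgroup (G ⧸ U)) : Set (G ⧸ U))).comap
    (QuotientGroup.mk' U) with hC
  have hmem : ∀ {x}, x ∈ C ↔ ∀ y ∈ K, ⁅y, x⁆ ∈ U := mem_comap_mk'_centralizer_iff
  have : (K.map (QuotientGroup.mk' U)).Normal := this.map _ (QuotientGroup.mk'_surjective U)
  have hCn : C.Normal := inferInstance
  have hUC : U ≤ C := fun u hu => hmem.2 fun y _ =>
    commutator_le_right ⊤ U (commutator_mem_commutator (mem_top y) hu)
  have hN : (P ⊓ C).Normal := by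
    rw [← normalizer_eq_top_iff, ← top_le_iff, ← h.le_sup, sup_le_iff]
    constructor <;> rw [le_normalizer_iff_commutator_le_right, Subgroup.commutator_le]
    · rintro y hy z ⟨-, hz⟩
      have := hmem.1 hz y hy
      exact ⟨h.le this, hUC this⟩
    · rintro y hy z ⟨hz, hz'⟩
      exact ⟨commutator_le_self P (commutator_mem_commutator hy hz),
        commutator_le_right ⊤ C (commutator_mem_commutator (mem_top y) hz')⟩
  exact h.le_of_normal _ hN (h.isPGroup.to_le inf_le_left) ⟨hxP, hmem.2 hx⟩

variable [hp : Fact p.Prime]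

theorem inf_le (h : MinimalConfiguration p P U K) : K ⊓ P ≤ U := by
  rintro g ⟨hK, hP⟩
  obtain ⟨m, hm, hmK⟩ := h.exists_pow
  obtain ⟨k, hk⟩ := h.isPGroup ⟨g, hP⟩
  have hk' : g ^ p ^ k = 1 := congrArg Subtype.val hk
  exact mem_of_pow_mem_of_pow_eq_one (coprime_pow_of_not_dvd hm k).symm hk' (hmK g hK)

/-- An element of `P` outside `U` acts quadratically on a normal subgroup `W ≤ U` only if the
`p'`-elements of `K` centralize `W`. -/
theorem commute_of_quadratic [Finite G] (h : MinimalConfiguration p P U K) (hp2 : p ≠ 2)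
    {x : G} (hxP : x ∈ P) (hxU : x ∉ U) {W : Subgroup G} (hW : W.Normal) (hWU : W ≤ U)
    (hx : ∀ w ∈ W, Commute ⁅w, x⁆ x) {y : G} (hy : y ∈ K) (hyp : ¬ p ∣ orderOf y) :
    ∀ w ∈ W, Commute y w := by
  induction hn : Nat.card W using Nat.strong_induction_on generalizing W with
  | _ n ih =>
  subst hn
  have := h.normal
  have := h.normal'
  have hUp : IsPGroup p U := h.isPGroup.to_le h.le
  by_cases hbot : W = ⊥
  · rintro w hw
    rw [hbot, mem_bot] at hw
    rw [hw]
    exact Commute.one_right y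
  have hlt := hUp.commutator_lt_of_le hWU hbot
  set W₁ := ⁅W, U⁆
  have hW₁ : W₁.Normal := inferInstance
  have hWW : ⁅W, W⁆ ≤ W₁ := commutator_mono le_rfl hWU
  have hcard : Nat.card W₁ < Nat.card W := by
    refine lt_of_le_of_ne (card_le_of_le hlt.le) fun he => ?_
    exact hlt.ne (eq_of_le_of_card_ge hlt.le he.ge)
  have ih₁ := ih _ hcard hW₁ (hlt.le.trans hWU) (fun w hw => hx w (hlt.le hw)) rfl
  set q := QuotientGroup.mk' W₁
  set V := W.map q with hV
  have hVn : V.Normal := hW.map q (QuotientGroup.mk'_surjective W₁)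
  set C := (centralizer (V : Set (G ⧸ W₁))).comap q with hC
  have hmem : ∀ {x}, x ∈ C ↔ ∀ w ∈ W, ⁅w, x⁆ ∈ W₁ := mem_comap_mk'_centralizer_iff
  have hCn : C.Normal := inferInstance
  have hUC : U ≤ C := fun u hu => hmem.2 fun w hw => commutator_mem_commutator hw hu
  have hVc : IsMulCommutative V := by
    rw [← commutator_self_eq_bot_iff, hV, ← map_commutator, Subgroup.map_eq_bot_iff,
      QuotientGroup.ker_mk']
    exact hWW
  have hcomm : ∀ z ∈ K, ⁅x, z⁆ ∈ C := by
    intro z hz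
    obtain ⟨m, hm, hmK⟩ := h.exists_pow
    have hKK : ∀ a ∈ K, ⁅z, a⁆ ∈ C := fun a ha =>
      hUC (h.commutator_le (commutator_mem_commutator hz ha))
    have hz₁ : x * z * x⁻¹ ∈ K := h.normal'.conj_mem z hz x
    have := commutatorElement_mem_centralizer_of_quadratic hp2 (V := V)
      ((hUp.to_le hWU).map q) (x := q x) (y := q z) (m := m) ?_ hm ?_ ?_ ?_
    · rw [← map_commutatorElement] at this
      exact this
    · rintro _ ⟨w, hw, rfl⟩
      rw [← map_commutatorElement]
      exact (hx w hw).map q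
    · rw [← map_pow]
      exact hUC (hmK z hz)
    · rw [← map_inv, ← map_mul, ← map_mul, ← map_commutatorElement]
      exact hKK _ hz₁
    · rw [← map_inv, ← map_mul, ← map_mul, ← map_mul, ← map_mul, ← map_commutatorElement]
      exact hKK _ (h.normal'.conj_mem _ hz₁ x)
  have hyC : y ∈ C := by
    by_cases hB : K ⊓ C ≤ P
    · refine absurd (h.mem_of_commutator_mem hxP fun z hz => ?_) hxU
      rw [← commutatorElement_inv]
      refine inv_mem (h.inf_le ?_)
      have hK : ⁅x, z⁆ ∈ K := commutator_le_right ⊤ K (commutator_mem_commutator (mem_top x) hz)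
      exact ⟨hK, hB ⟨hK, hcomm z hz⟩⟩
    · have htop : (K ⊓ C) ⊔ P = ⊤ := by
        rw [sup_comm]
        exact h.isCoatom.2 _ (left_lt_sup.2 hB)
      obtain ⟨b, hb, s, hs, rfl⟩ := mem_sup_of_normal_left.1 (htop ▸ mem_top y)
      have hsK : s ∈ K := by
        have := K.mul_mem (K.inv_mem hb.1) hy
        rwa [inv_mul_cancel_left] at this
      exact mul_mem hb.2 (hUC (h.inf_le ⟨hsK, hs⟩))
  intro w hw
  set c := ⁅y, w⁆ with hc
  have hcW : c ∈ W₁ := by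
    rw [hc, ← commutatorElement_inv]
    exact inv_mem (hmem.1 hyC w hw)
  have hyc : Commute y c := ih₁ c hcW
  have hpow : ∀ k : ℕ, y ^ k * w = c ^ k * w * y ^ k := by
    intro k
    induction k with
    | zero => simp
    | succ k ihk =>
      have e : y * w = c * w * y := by rw [hc, commutatorElement_def]; group
      calc y ^ (k + 1) * w = y * (y ^ k * w) := by rw [pow_succ', mul_assoc]
        _ = (y * c ^ k) * w * y ^ k := by rw [ihk]; simp only [mul_assoc]
        _ = c ^ k * (y * w) * y ^ k := by rw [(hyc.pow_right k).eq]; simp only [mul_assoc]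
        _ = c ^ (k + 1) * w * y ^ (k + 1) := by
          rw [e, pow_succ, pow_succ' y]; simp only [mul_assoc]
  have h1 := hpow (orderOf y)
  rw [pow_orderOf_eq_one, one_mul, mul_one, right_eq_mul] at h1
  have hc1 : c = 1 := by
    refine hUp.eq_one_of_not_dvd (hWU (hlt.le hcW)) fun hd => hyp (hd.trans ?_)
    exact orderOf_dvd_of_pow_eq_one h1
  exact commutatorElement_eq_one_iff_commute.1 hc1

theorem exists_notMem [Finite G] (h : MinimalConfiguration p P U K) :
    ∃ y ∈ K, ¬ p ∣ orderOf y ∧ y ∉ P := by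
  by_contra! hall
  have hKp : IsPGroup p K := isPGroup_of_forall_not_dvd fun g hg => by
    rw [← Subgroup.orderOf_coe] at hg
    exact Subtype.ext (h.isPGroup.eq_one_of_not_dvd (hall g g.2 hg) hg)
  have hKP : K ≤ P := (h.le_of_normal K h.normal' hKp).trans h.le
  have := h.le_sup
  rw [sup_eq_right.2 hKP] at this
  exact h.isCoatom.1 this

theorem dstar_le [Finite G] (h : MinimalConfiguration p P U K) (hp2 : p ≠ 2) : dstar P ≤ U := by
  intro x hx
  by_contra hxU
  have hD := isQuadraticallyClosed_dstar h.isPGroup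
  have hPD : P ≤ normalizer (dstar P : Set G) :=
    le_normalizer.trans (normalizer_le_normalizer_dstar h.isPGroup)
  obtain ⟨y, hyK, hyp, hyP⟩ := h.exists_notMem
  have hc := h.commute_of_quadratic hp2 (hD.le hx) hxU h.normal le_rfl (fun w hw =>
    hD.commute _ (le_normalizer_iff_commutator_le_right.1 hPD
      (commutator_mem_commutator (h.le hw) hx)) _ hx) hyK hyp
  exact hyP (h.le (h.centralizer_le (mem_centralizer_iff.2 fun u hu => (hc u hu).symm.eq)))

theorem dstar_normal [Finite G] (h : MinimalConfiguration p P U K) (hp2 : p ≠ 2) :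
    (dstar P).Normal := by
  have hUn := h.normal
  have hD := isQuadraticallyClosed_dstar h.isPGroup
  have hDU := h.dstar_le hp2
  have hPD : P ≤ normalizer (dstar P : Set G) :=
    le_normalizer.trans (normalizer_le_normalizer_dstar h.isPGroup)
  set D := dstar P
  have hmap : ∀ {N : Subgroup G}, N.Normal → ∀ g : G, N.map (MulAut.conj g).toMonoidHom = N :=
    fun {N} _ g => mem_normalizer_iff_map_conj_eq.1 (normalizer_eq_top (H := N) ▸ mem_top g)
  have hconj : ∀ d ∈ D, ∀ e ∈ D, ∀ g : G, Commute d (g * e * g⁻¹) := by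
    intro d hd e he g
    set f := (MulAut.conj g).toMonoidHom with hf
    have hB : ∀ a ∈ D.map f, ∀ b ∈ D.map f, Commute a b := by
      rintro _ ⟨a, ha, rfl⟩ _ ⟨b, hb, rfl⟩
      exact (hD.commute a ha b hb).map f
    have hBU : D.map f ≤ U := (map_mono hDU).trans (hmap hUn g).le
    have hAB : D ≤ normalizer ((D.map f : Subgroup G) : Set G) :=
      hDU.trans <| (hmap hUn g).ge.trans <| (map_mono (h.le.trans hPD)).trans
        (le_normalizer_map f)
    have hmem : g * e * g⁻¹ ∈ D.map f := ⟨e, he, rfl⟩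
    exact hD.commute_of_quadratic _ (h.le (hBU hmem)) (actsQuadratically_of_normalizes hD.commute
      hB hAB ((hBU.trans h.le).trans hPD) hmem) d hd
  set N := normalClosure (D : Set G) with hN
  have hDN : D ≤ N := le_normalClosure
  have hNn : N.Normal := normalClosure_normal
  have hNU : N ≤ U := normalClosure_le_normal hDU
  have hNcomm : ∀ x : G, (∀ g, ∀ d ∈ D, Commute (g * d * g⁻¹) x) → ∀ a ∈ N, Commute a x := by
    intro x hx
    have : N ≤ centralizer {x} := by
      rw [hN, normalClosure, closure_le]
      intro a ha
      obtain ⟨d, hd, hda⟩ := Group.mem_conjugatesOfSet_iff.1 ha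
      obtain ⟨g, rfl⟩ := isConj_iff.1 hda
      exact mem_centralizer_singleton_iff.2 (hx g d hd)
    exact fun a ha => mem_centralizer_singleton_iff.1 (this ha)
  have hback : ∀ (g d x : G), Commute d (g⁻¹ * x * g) → Commute (g * d * g⁻¹) x := by
    intro g d x hc
    have := hc.map (MulAut.conj g)
    simp only [MulAut.conj_apply] at this
    rwa [show g * (g⁻¹ * x * g) * g⁻¹ = x by group] at this
  by_cases hA : ∀ y ∈ K, ¬ p ∣ orderOf y → ∀ a ∈ N, Commute y a
  · by_contra hnn
    have heq : P = normalizer (D : Set G) := by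
      refine (eq_or_lt_of_le hPD).resolve_right fun hlt => hnn ?_
      exact normalizer_eq_top_iff.1 (h.isCoatom.2 _ hlt)
    obtain ⟨y, hyK, hyp, hyP⟩ := h.exists_notMem
    refine hyP (heq ▸ centralizer_le_normalizer _ (mem_centralizer_iff.2 fun d hd => ?_))
    exact (hA y hyK hyp d (hDN hd)).symm.eq
  · push Not at hA
    obtain ⟨y, hyK, hyp, a, ha, hya⟩ := hA
    have hNq : IsQuadraticallyClosed P N := by
      refine ⟨hNU.trans h.le, fun a ha b hb => ?_, fun x hxP hq => ?_⟩
      · refine hNcomm b (fun g d hd => (hNcomm _ (fun g' e he => ?_) b hb).symm) a ha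
        refine hback _ _ _ ?_
        have := hconj e he d hd (g'⁻¹ * g)
        rwa [show g'⁻¹ * g * d * (g'⁻¹ * g)⁻¹ = g'⁻¹ * (g * d * g⁻¹) * g' by group] at this
      · have hxU : x ∈ U := by
          by_contra hxU
          exact hya (h.commute_of_quadratic hp2 hxP hxU hNn hNU (fun w hw => (hq w hw).1)
            hyK hyp a ha)
        refine hNcomm x fun g d hd => hback _ _ _ ?_
        have hq' := (actsQuadratically_map_iff (P := ⊤) (f := (MulAut.conj g⁻¹).toMonoidHom)
          (MulAut.conj g⁻¹).injective.injOn le_top (mem_top x)).2 hq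
        rw [hmap hNn] at hq'
        have hx' : g⁻¹ * x * g ∈ U := by simpa using hUn.conj_mem x hxU g⁻¹
        refine hD.commute_of_quadratic _ (h.le hx') ?_ d hd
        have := hq'.mono hDN
        simpa using this
    have : N = D := le_antisymm hNq.le_dstar hDN
    rwa [← this]

end MinimalConfiguration

end MinimalConfiguration

section Structure

variable {G G' : Type*} [Group G] [Group G'] [Finite G] {p : ℕ} [hp : Fact p.Prime]

theorem IsPNilpotent.isPGroup_of_normal {N : Subgroup G} [N.Normal] (h : IsPNilpotent p N)
    (hG : ∀ Y : Subgroup G, Y.Normal → ¬ p ∣ Nat.card Y → Y = ⊥) : IsPGroup p N := by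
  obtain ⟨K, hK⟩ := h
  refine hK.isPGroup_of_eq_bot ?_
  have := hG _ hK.normal_map_subtype fun hd => hK.not_dvd (hd.trans (card_map_dvd K _))
  rwa [map_eq_bot_iff_of_injective _ N.subtype_injective] at this

/-- Burnside: a group whose `p`-elements are central is `p`-nilpotent. -/
theorem isPNilpotent_of_forall_mem_center (h : ∀ g : G, (∃ k : ℕ, g ^ p ^ k = 1) → g ∈ center G) :
    IsPNilpotent p G := by
  obtain ⟨P⟩ : Nonempty (Sylow p G) := inferInstance
  have hP : normalizer ((P : Subgroup G) : Set G) ≤ centralizer (P : Set G) := by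
    intro g _
    refine mem_centralizer_iff.2 fun s hs => ?_
    obtain ⟨k, hk⟩ := P.2 ⟨s, hs⟩
    exact (mem_center_iff.1 (h s ⟨k, congrArg Subtype.val hk⟩) g).symm
  refine ⟨(MonoidHom.transferSylow P hP).ker, inferInstance,
    MonoidHom.not_dvd_card_ker_transferSylow P hP, fun g => ?_⟩
  obtain ⟨k, hk⟩ := P.2 (MonoidHom.transferSylow P hP g)
  exact ⟨k, by rw [MonoidHom.mem_ker, map_pow, hk]⟩

/-- If `U` is the largest normal `p`-subgroup of `G`, `K / U` is a normal `p`-complement of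
`G / U`, and `G` has no nontrivial normal `p'`-subgroup, then `C(U) ≤ U`. -/
theorem centralizer_le_of_normal_complement {U K : Subgroup G} [U.Normal] [K.Normal]
    (hU : ∀ N : Subgroup G, N.Normal → IsPGroup p N → N ≤ U)
    (hG : ∀ Y : Subgroup G, Y.Normal → ¬ p ∣ Nat.card Y → Y = ⊥)
    (hK : ∃ m, ¬ p ∣ m ∧ ∀ y ∈ K, y ^ m ∈ U) (hGK : ∀ g : G, ∃ k : ℕ, g ^ p ^ k ∈ K) :
    centralizer (U : Set G) ≤ U := by
  set C := centralizer (U : Set G)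
  have hL : IsPNilpotent p (C ⊓ K : Subgroup G) := by
    refine isPNilpotent_of_forall_mem_center ?_
    rintro ⟨g, hgC, hgK⟩ ⟨k, hk⟩
    obtain ⟨m, hm, hmK⟩ := hK
    have hgU : g ∈ U := mem_of_pow_mem_of_pow_eq_one (coprime_pow_of_not_dvd hm k).symm
      (congrArg Subtype.val hk) (hmK g hgK)
    rw [mem_center_iff]
    rintro ⟨z, hzC, hzK⟩
    exact Subtype.ext (mem_centralizer_iff.1 hzC g hgU).symm
  have hLp := hL.isPGroup_of_normal hG
  refine hU C inferInstance ?_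
  rintro ⟨c, hc⟩
  obtain ⟨k, hk⟩ := hGK c
  obtain ⟨l, hl⟩ := hLp ⟨c ^ p ^ k, pow_mem hc _, hk⟩
  refine ⟨k + l, Subtype.ext ?_⟩
  have := congrArg Subtype.val hl
  rw [pow_add, pow_mul]
  exact this

/-- Frattini argument: normalizers of `p`-subgroups lift along surjections with `p'`-kernel. -/
theorem normalizer_map_le_of_not_dvd_card_ker {f : G →* G'} (hf : Function.Surjective f)
    (hker : ¬ p ∣ Nat.card f.ker) {D : Subgroup G} (hD : IsPGroup p D) :
    normalizer ((D.map f : Subgroup G') : Set G') ≤ (normalizer (D : Set G)).map f := by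
  intro y hy
  obtain ⟨g, rfl⟩ := hf y
  set E := D ⊔ f.ker with hE
  have hDE : D ≤ E := le_sup_left
  set D₂ := D.map (MulAut.conj g).toMonoidHom with hD₂
  have hD₂E : D₂ ≤ E := by
    rw [hE, ← comap_map_eq]
    rintro _ ⟨d, hd, rfl⟩
    have := (mem_normalizer_iff.1 hy (f d)).1 (mem_map_of_mem f hd)
    simpa using this
  obtain ⟨S, hS⟩ := (hD.comap_subtype (K := E)).exists_le_sylow
  obtain ⟨T, hT⟩ := ((hD.map (MulAut.conj g).toMonoidHom).comap_subtype (K := E)).exists_le_sylow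
  have hSD : ∀ s : E, s ∈ S → (s : G) ∈ D := by
    intro s hs
    obtain ⟨d, hd, y, hy, hdy⟩ := mem_sup_of_normal_right.1 s.2
    have hy' : (⟨d, hDE hd⟩ : E)⁻¹ * s ∈ S := mul_mem (inv_mem (hS hd)) hs
    have e : (((⟨d, hDE hd⟩ : E)⁻¹ * s : E) : G) = y := by
      simp [← hdy]
    have h1 := S.2.eq_one_of_not_dvd hy' (by
      rw [← Subgroup.orderOf_coe, e]
      exact not_dvd_card_iff_forall_orderOf.1 hker y hy)
    rw [h1] at e
    rw [← hdy, ← e]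
    simpa using hd
  obtain ⟨e, he⟩ := MulAction.exists_smul_eq E T S
  have hle : D₂.map (MulAut.conj (e : G)).toMonoidHom ≤ D := by
    rintro _ ⟨x, hx, rfl⟩
    have hxT : (⟨x, hD₂E hx⟩ : E) ∈ T := hT hx
    have : e * ⟨x, hD₂E hx⟩ * e⁻¹ ∈ S := by
      rw [← he, ← SetLike.mem_coe, Sylow.coe_smul, Set.mem_smul_set_iff_inv_smul_mem]
      have h2 : (⟨x, hD₂E hx⟩ : E) ∈ (T : Set E) := hxT
      simpa [← mul_assoc] using h2
    exact hSD _ this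
  have hconj : ∀ a : G, Function.Injective (MulAut.conj a).toMonoidHom :=
    fun a => (MulAut.conj a).injective
  have heq : D₂.map (MulAut.conj (e : G)).toMonoidHom = D := by
    refine eq_of_le_of_card_ge hle ?_
    rw [card_map_of_injective (hconj _), hD₂, card_map_of_injective (hconj _)]
  have hN : (e : G) * g ∈ normalizer (D : Set G) := by
    rw [mem_normalizer_iff_map_conj_eq, map_mul]
    rw [hD₂, map_map] at heq
    exact heq
  have heN : f e⁻¹ ∈ (normalizer (D : Set G)).map f := by
    obtain ⟨d, hd, y, hy, hdy⟩ := mem_sup_of_normal_right.1 (e⁻¹).2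
    rw [InvMemClass.coe_inv] at hdy
    rw [← hdy, map_mul, MonoidHom.mem_ker.1 hy, mul_one]
    exact mem_map_of_mem f (le_normalizer hd)
  have := mul_mem heN (mem_map_of_mem f hN)
  rwa [← map_mul, inv_mul_cancel_left] at this

end Structure

section Thompson

universe u

variable {G : Type u} [Group G] [Finite G] {p : ℕ} [hp : Fact p.Prime]

theorem isPNilpotent_normalizer_dstar_sylow {P : Sylow p G}
    (h : IsPNilpotent p (normalizer (dstar (P : Subgroup G) : Set G))) (S : Sylow p G) :
    IsPNilpotent p (normalizer (dstar (S : Subgroup G) : Set G)) := by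
  obtain ⟨g, rfl⟩ := MulAction.exists_smul_eq G S P
  have hg : Function.Injective (MulAut.conj g).toMonoidHom := (MulAut.conj g).injective
  refine IsPNilpotent.normalizer_of_map (MulAut.conj g).toMonoidHom hg ?_
  rw [map_dstar S.2 hg.injOn]
  exact h

section Induction

variable (ih : ∀ (H : Type u) [Group H] [Finite H], Nat.card H < Nat.card G →
    ∀ S : Sylow p H, IsPNilpotent p (normalizer (dstar (S : Subgroup H) : Set H)) →
      IsPNilpotent p H)

include ih

theorem isPNilpotent_of_lt_top {H : Subgroup G} (hH : H ≠ ⊤) (S : Sylow p H)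
    (h : IsPNilpotent p (normalizer (dstar ((S : Subgroup H).map H.subtype) : Set G))) :
    IsPNilpotent p H := by
  refine ih H ?_ S (IsPNilpotent.normalizer_of_map H.subtype H.subtype_injective ?_)
  · simpa using Set.Finite.card_lt_card (Set.toFinite _) (lt_top_iff_ne_top.2 hH : H < ⊤)
  · rwa [map_dstar S.2 H.subtype_injective.injOn]

theorem isPNilpotent_of_sylow_le {H : Subgroup G} (hH : H ≠ ⊤) {P : Sylow p G}
    (hP : (P : Subgroup G) ≤ H)
    (h : IsPNilpotent p (normalizer (dstar (P : Subgroup G) : Set G))) :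
    IsPNilpotent p H := by
  refine isPNilpotent_of_lt_top ih hH (P.subtype hP) ?_
  rwa [Sylow.coe_subtype, map_subgroupOf_eq_of_le hP]

theorem exists_normal_isPGroup {P : Sylow p G}
    (h : IsPNilpotent p (normalizer (dstar (P : Subgroup G) : Set G)))
    (hG : ¬ IsPNilpotent p G) :
    ∃ U : Subgroup G, U.Normal ∧ U ≠ ⊥ ∧ IsPGroup p U := by
  by_contra hno
  let s : Set (Subgroup G) :=
    {U | U ≠ ⊥ ∧ IsPGroup p U ∧ ¬ IsPNilpotent p (normalizer (U : Set G))}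
  have hs : s.Nonempty := by
    by_contra hs
    refine hG (isPNilpotent_of_forall_normalizer fun U hU hUp => ?_)
    by_contra hN
    exact hs ⟨U, hU, hUp, hN⟩
  obtain ⟨U, ⟨hU, hUp, hUN⟩, hmax⟩ := Set.exists_max_image s
    (fun U => (Nat.card (normalizer (U : Set G))).factorization p) (Set.toFinite _) hs
  set H := normalizer (U : Set G) with hH
  have hHtop : H ≠ ⊤ := fun he => hno ⟨U, normalizer_eq_top_iff.1 he, hU, hUp⟩
  obtain ⟨R⟩ : Nonempty (Sylow p H) := inferInstance
  refine hUN (isPNilpotent_of_lt_top ih hHtop R ?_)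
  set R' := (R : Subgroup H).map H.subtype with hR'
  have hR'p : IsPGroup p R' := R.2.map _
  obtain ⟨S, hS⟩ := hR'p.exists_le_sylow
  rcases hS.eq_or_lt with he | hlt
  · rw [he]
    exact isPNilpotent_normalizer_dstar_sylow h S
  have hUR : U ≤ R' := by
    have : (U.subgroupOf H).Normal := normal_in_normalizer
    have h1 : U.subgroupOf H ≤ R :=
      IsPGroup.le_sylow_of_normal (N := U.subgroupOf H) hUp.comap_subtype R
    rw [← map_subgroupOf_eq_of_le (le_normalizer : U ≤ H)]
    exact map_mono h1
  have hR'bot : R' ≠ ⊥ := fun he => hU (le_bot_iff.1 (he ▸ hUR))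
  by_contra hN
  have hle := hmax (dstar R') ⟨dstar_ne_bot hR'p hR'bot,
    hR'p.to_le (isQuadraticallyClosed_dstar hR'p).le, hN⟩
  obtain ⟨x, hxS, hxR, hxN⟩ := S.2.exists_normalizer_notMem hlt
  set L : Subgroup G := S ⊓ normalizer (R' : Set G)
  have hRL : R' < L := by
    refine lt_of_le_of_ne (le_inf hS le_normalizer) fun he => hxR ?_
    rw [he]
    exact ⟨hxS, hxN⟩
  have hcard := Set.Finite.card_lt_card (Set.toFinite _) hRL
  obtain ⟨l, hl⟩ := IsPGroup.iff_card.1 (S.2.to_le (inf_le_left : L ≤ S))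
  have hLN : L ≤ normalizer (dstar R' : Set G) :=
    inf_le_right.trans (normalizer_le_normalizer_dstar hR'p)
  have hdvd : p ^ l ∣ Nat.card (normalizer (dstar R' : Set G)) := by
    rw [← hl]
    exact card_dvd_of_le hLN
  rw [hp.out.pow_dvd_iff_le_factorization Nat.card_pos.ne'] at hdvd
  have hRc : Nat.card R' = p ^ (Nat.card H).factorization p := by
    rw [hR', card_map_of_injective H.subtype_injective]
    exact R.card_eq_multiplicity
  have : Nat.card R' < Nat.card L := hcard
  rw [hRc, hl, Nat.pow_lt_pow_iff_right hp.out.one_lt] at this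
  omega

theorem eq_bot_of_not_dvd_card {P : Sylow p G}
    (h : IsPNilpotent p (normalizer (dstar (P : Subgroup G) : Set G)))
    (hG : ¬ IsPNilpotent p G) (Y : Subgroup G) (hY : Y.Normal) (hYp : ¬ p ∣ Nat.card Y) :
    Y = ⊥ := by
  by_contra hbot
  refine hG ?_
  have hq := QuotientGroup.mk'_surjective Y
  have hker : ¬ p ∣ Nat.card (QuotientGroup.mk' Y).ker := by
    rwa [QuotientGroup.ker_mk']
  have hinj : Set.InjOn (QuotientGroup.mk' Y) (P : Subgroup G) := by
    intro a ha b hb hab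
    have : a⁻¹ * b ∈ Y := QuotientGroup.eq.1 hab
    have h1 : a⁻¹ * b ∈ ((P : Subgroup G) ⊓ Y : Subgroup G) := 
        ⟨Subgroup.mul_mem _ (Subgroup.inv_mem _ ha) hb, this⟩
    rw [P.2.disjoint_of_not_dvd hYp, mem_bot] at h1
    exact inv_mul_eq_one.1 h1
  refine IsPNilpotent.of_not_dvd_card_ker _ hker (ih (G ⧸ Y) ?_ (P.mapSurjective hq) ?_)
  · have h1 := Y.card_eq_card_quotient_mul_card_subgroup
    have h2 : 1 < Nat.card Y := Y.one_lt_card_iff_ne_bot.2 hbot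
    have h3 : 0 < Nat.card (G ⧸ Y) := Nat.card_pos
    nlinarith
  · refine (h.map (QuotientGroup.mk' Y)).mono ?_
    rw [Sylow.coe_mapSurjective, ← map_dstar P.2 hinj]
    exact normalizer_map_le_of_not_dvd_card_ker hq hker
      (P.2.to_le (isQuadraticallyClosed_dstar P.2).le)

end Induction

end Thompson

theorem Subgroup.le_of_sup_eq_top {G : Type*} [Group G] {F K P U : Subgroup G} [F.Normal]
    (hFK : F ≤ K) (hFP : F ⊔ P = ⊤) (hKP : K ⊓ P ≤ U) (hUF : U ≤ F) : K ≤ F := by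
  intro k hk
  obtain ⟨f, hf, s, hs, rfl⟩ := mem_sup_of_normal_left.1 (hFP ▸ mem_top k : k ∈ F ⊔ P)
  exact mul_mem hf (hUF (hKP ⟨(mul_mem_cancel_left (hFK hf)).1 hk, hs⟩))

theorem pow_card_mem_of_mem_comap_mk' {G : Type*} [Group G] {U : Subgroup G} [U.Normal]
    {K : Subgroup (G ⧸ U)} {y : G} (hy : y ∈ K.comap (QuotientGroup.mk' U)) :
    y ^ Nat.card K ∈ U := by
  rw [← QuotientGroup.eq_one_iff, QuotientGroup.mk_pow]
  exact congrArg Subtype.val (pow_card_eq_one' (x := (⟨_, hy⟩ : K)))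

theorem le_comap_mk' {G : Type*} [Group G] (U : Subgroup G) [U.Normal] (K : Subgroup (G ⧸ U)) :
    U ≤ K.comap (QuotientGroup.mk' U) := by
  intro x hx
  rw [mem_comap, QuotientGroup.mk'_apply, (QuotientGroup.eq_one_iff x).2 hx]
  exact K.one_mem

theorem IsNormalComplement.comap_inf_le {G : Type*} [Group G] {p : ℕ} [Fact p.Prime]
    {U : Subgroup G} [U.Normal] {K : Subgroup (G ⧸ U)} (hK : IsNormalComplement p K)
    {P : Subgroup G} (hP : IsPGroup p P) :
    K.comap (QuotientGroup.mk' U) ⊓ P ≤ U := by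
  rintro x ⟨hxK, hxP⟩
  obtain ⟨k, hk⟩ := hP ⟨x, hxP⟩
  exact mem_of_pow_mem_of_pow_eq_one (coprime_pow_of_not_dvd hK.not_dvd k).symm
    (congrArg Subtype.val hk) (pow_card_mem_of_mem_comap_mk' hxK)

section Structure

variable {G : Type*} [Group G] [Finite G] {p : ℕ} [hp : Fact p.Prime]

/-- If the Sylow `p`-subgroups are maximal subgroups, a normal `p`-complement of the quotient by
the largest normal `p`-subgroup has prime power order. -/
theorem IsNormalComplement.exists_isPGroup {U : Subgroup G} [U.Normal] {K : Subgroup (G ⧸ U)}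
    (hK : IsNormalComplement p K)
    (hcoatom : ∀ P : Sylow p G, IsCoatom (P : Subgroup G)) :
    ∃ r : ℕ, r.Prime ∧ IsPGroup r K := by
  by_cases hbot : K = ⊥
  · exact ⟨p, hp.out, hbot ▸ IsPGroup.of_bot⟩
  have hcard : Nat.card K ≠ 1 := fun he => hbot (card_eq_one.1 he)
  set r := (Nat.card K).minFac with hr
  have hrp : Fact r.Prime := ⟨Nat.minFac_prime hcard⟩
  have hrK : r ∣ Nat.card K := Nat.minFac_dvd _
  have hne : r ≠ p := fun he => hK.not_dvd (he ▸ hrK)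
  refine ⟨r, hrp.out, ?_⟩
  have := hK.normal
  set f := QuotientGroup.mk' U with hf
  have hfs : Function.Surjective f := QuotientGroup.mk'_surjective U
  set L := K.comap f with hL
  have hLK : L.map f = K := map_comap_eq_self_of_surjective hfs K
  have hUL : U ≤ L := le_comap_mk' U K
  have hrL : r ∣ Nat.card L := by
    refine hrK.trans ?_
    rw [← hLK]
    exact card_map_dvd L f
  obtain ⟨Q⟩ : Nonempty (Sylow r L) := inferInstance
  set Q' := (Q : Subgroup L).map L.subtype with hQ'
  have hQ'p : IsPGroup r Q' := Q.2.map _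
  have hQ'bot : Q' ≠ ⊥ := by
    rw [hQ', Ne, map_eq_bot_iff_of_injective _ L.subtype_injective]
    exact Q.ne_bot_of_dvd_card hrL
  have hQ'L : Q' ≤ L := map_subtype_le _
  set J := Q' ⊔ U with hJ
  have hJL : J ≤ L := sup_le hQ'L hUL
  set M := normalizer (J : Set G) with hM
  have hQM : normalizer (Q' : Set G) ≤ M := by
    intro g hg
    rw [mem_normalizer_iff_map_conj_eq] at hg ⊢
    rw [hJ, Subgroup.map_sup]
    congr 1
    exact mem_normalizer_iff_map_conj_eq.1 (normalizer_eq_top (H := U) ▸ mem_top g)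
  have htop : M ⊔ L = ⊤ :=
    top_le_iff.1 ((Q.normalizer_sup_eq_top).ge.trans (sup_le_sup_right hQM L))
  have hindex : ¬ p ∣ M.index := by
    intro hd
    refine hK.not_dvd (hd.trans ?_)
    have hUM : U ≤ M := le_sup_right.trans le_normalizer
    have h1 : M.relIndex L = M.index := by
      have e1 := relIndex_mul_index (inf_le_left : M ⊓ L ≤ M)
      have e2 := relIndex_mul_index (inf_le_right : M ⊓ L ≤ L)
      rw [inf_relIndex_left, ← relIndex_sup_right, htop, relIndex_top_right, mul_comm] at e1
      rw [inf_relIndex_right, ← e1] at e2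
      exact Nat.eq_of_mul_eq_mul_right (Nat.pos_of_ne_zero L.index_ne_zero_of_finite) e2
    have h2 : U.relIndex L = Nat.card K := by
      have := relIndex_ker (K := L) f
      rwa [hLK, hf, QuotientGroup.ker_mk'] at this
    rw [← h1, ← h2]
    exact relIndex_dvd_of_le_left L hUM
  obtain ⟨S⟩ : Nonempty (Sylow p M) := inferInstance
  let P : Sylow p G := Sylow.ofCard ((S : Subgroup M).map M.subtype) (by
    rw [card_map_of_injective M.subtype_injective, S.card_eq_multiplicity,
      ← M.card_mul_index, Nat.factorization_mul Nat.card_pos.ne' M.index_ne_zero_of_finite,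
      Finsupp.add_apply, Nat.factorization_eq_zero_of_not_dvd hindex, add_zero])
  have hPM : (P : Subgroup G) ≤ M := map_subtype_le _
  have hsup : J ⊔ P = ⊤ := by
    by_contra hn
    have hJP : J ≤ P := by
      by_contra hle
      exact hn ((hcoatom P).2 _ (right_lt_sup.2 hle))
    have := IsPGroup.disjoint_of_ne r p hne Q' P hQ'p P.2
    exact hQ'bot (this.eq_bot_of_le (le_sup_left.trans hJP))
  have hJn : J.Normal := by
    rw [← normalizer_eq_top_iff, eq_top_iff, ← hsup]
    exact sup_le le_normalizer hPM
  have hLJ : L ≤ J := le_of_sup_eq_top hJL hsup (hK.comap_inf_le P.2) le_sup_right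
  have hKQ : K = Q'.map f := by
    refine le_antisymm ?_ (by rw [← hLK]; exact map_mono hQ'L)
    have : U.map f = ⊥ := (Subgroup.map_eq_bot_iff U).2 (by rw [hf, QuotientGroup.ker_mk'])
    rw [← hLK]
    refine (map_mono hLJ).trans ?_
    rw [hJ, Subgroup.map_sup, this, sup_bot_eq]
  rw [hKQ]
  exact hQ'p.map f

theorem IsNormalComplement.commutator_comap_le {U : Subgroup G} [U.Normal] {K : Subgroup (G ⧸ U)}
    (hK : IsNormalComplement p K)
    (hcoatom : ∀ P : Sylow p G, IsCoatom (P : Subgroup G)) :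
    ⁅K.comap (QuotientGroup.mk' U), K.comap (QuotientGroup.mk' U)⁆ ≤ U := by
  obtain ⟨r, hr, hrK⟩ := hK.exists_isPGroup hcoatom
  have : Fact r.Prime := ⟨hr⟩
  have := hK.normal
  set f := QuotientGroup.mk' U with hf
  have hUf : U.map f = ⊥ := (Subgroup.map_eq_bot_iff U).2 (by rw [hf, QuotientGroup.ker_mk'])
  set L := K.comap f with hL
  have hLK : L.map f = K := map_comap_eq_self_of_surjective (QuotientGroup.mk'_surjective U) K
  have hUL : U ≤ L := le_comap_mk' U K
  set F := ⁅L, L⁆ ⊔ U with hF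
  have hFL : F ≤ L := sup_le (commutator_le_self L) hUL
  obtain ⟨P⟩ : Nonempty (Sylow p G) := inferInstance
  refine (le_sup_left : ⁅L, L⁆ ≤ F).trans ?_
  by_cases hFP : F ≤ P
  · exact (le_inf hFL hFP).trans (hK.comap_inf_le P.2)
  have hLF : L ≤ F := le_of_sup_eq_top hFL ((hcoatom P).2 _ (right_lt_sup.2 hFP))
    (hK.comap_inf_le P.2) le_sup_right
  have hKK : K ≤ ⁅K, K⁆ := by
    have := map_mono (f := f) hLF
    rwa [hF, Subgroup.map_sup, hUf, sup_bot_eq, map_commutator, hLK] at this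
  have hbot : K = ⊥ := by
    by_contra hbot
    exact (hrK.commutator_lt hbot).not_ge hKK
  refine hFL.trans ?_
  rw [hL, hbot, MonoidHom.comap_bot, hf, QuotientGroup.ker_mk']

end Structure

section Thompson

universe u

variable {G : Type u} [Group G] [Finite G] {p : ℕ} [hp : Fact p.Prime]

variable (ih : ∀ (H : Type u) [Group H] [Finite H], Nat.card H < Nat.card G →
    ∀ S : Sylow p H, IsPNilpotent p (normalizer (dstar (S : Subgroup H) : Set H)) →
      IsPNilpotent p H)

include ih

theorem isPNilpotent_quotient {P : Sylow p G}
    (h : IsPNilpotent p (normalizer (dstar (P : Subgroup G) : Set G)))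
    {U : Subgroup G} [U.Normal] (hUbot : U ≠ ⊥) (hUp : IsPGroup p U)
    (hU : ∀ N : Subgroup G, N.Normal → IsPGroup p N → N ≤ U) : IsPNilpotent p (G ⧸ U) := by
  set f := QuotientGroup.mk' U with hf
  have hfs : Function.Surjective f := QuotientGroup.mk'_surjective U
  have hker : f.ker = U := QuotientGroup.ker_mk' U
  set S := P.mapSurjective hfs with hS
  have hlt : Nat.card (G ⧸ U) < Nat.card G := by
    have h1 := U.card_eq_card_quotient_mul_card_subgroup
    have h2 : 1 < Nat.card U := U.one_lt_card_iff_ne_bot.2 hUbot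
    have h3 : 0 < Nat.card (G ⧸ U) := Nat.card_pos
    nlinarith
  have hDp : IsPGroup p (dstar (S : Subgroup (G ⧸ U))) :=
    S.2.to_le (isQuadraticallyClosed_dstar S.2).le
  set N := normalizer (dstar (S : Subgroup (G ⧸ U)) : Set (G ⧸ U)) with hN
  by_cases htop : N = ⊤
  · have : (dstar (S : Subgroup (G ⧸ U))).Normal := normalizer_eq_top_iff.1 htop
    have hle := hU ((dstar (S : Subgroup (G ⧸ U))).comap f) inferInstance
      (hDp.comap_of_ker_isPGroup f (by rwa [hker]))
    have hDbot : dstar (S : Subgroup (G ⧸ U)) = ⊥ := by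
      rw [← map_comap_eq_self_of_surjective hfs (dstar (S : Subgroup (G ⧸ U))),
        Subgroup.map_eq_bot_iff, hker]
      exact hle
    refine IsPNilpotent.of_not_dvd_card fun hd => ?_
    exact dstar_ne_bot S.2 (S.ne_bot_of_dvd_card hd) hDbot
  · refine ih (G ⧸ U) hlt S ?_
    have hHtop : N.comap f ≠ ⊤ := fun he => htop (by
      rw [← map_comap_eq_self_of_surjective hfs N, he, map_top_of_surjective f hfs])
    have hPN : (P : Subgroup G) ≤ N.comap f := by
      rw [← map_le_iff_le_comap]
      exact (le_normalizer (H := (S : Subgroup (G ⧸ U)))).trans (normalizer_le_normalizer_dstar S.2)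
    have := (isPNilpotent_of_sylow_le ih hHtop hPN h).map f
    rwa [map_comap_eq_self_of_surjective hfs N] at this

theorem isCoatom_sylow {P : Sylow p G}
    (h : IsPNilpotent p (normalizer (dstar (P : Subgroup G) : Set G)))
    (hG : ¬ IsPNilpotent p G) {U : Subgroup G} [U.Normal] (hUp : IsPGroup p U)
    (hC : centralizer (U : Set G) ≤ U) : IsCoatom (P : Subgroup G) := by
  refine ⟨fun he => hG (isPNilpotent_top.1 ?_), fun H hlt => ?_⟩
  · rw [← he]
    exact P.2.isPNilpotent
  by_contra hH
  obtain ⟨Y, hY⟩ := isPNilpotent_of_sylow_le ih hH hlt.le h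
  have hUH : U ≤ H := (hUp.le_sylow_of_normal P).trans hlt.le
  have hYU : ∀ y ∈ Y, (y : G) ∈ U := by
    refine fun y hy => hC (mem_centralizer_iff.2 fun u hu => ?_)
    have := hY.commute_of_normal (N := U.subgroupOf H) hUp.comap_subtype
      (x := ⟨u, hUH hu⟩) (mem_subgroupOf.2 hu) hy
    exact congrArg Subtype.val this.eq
  have hYbot : Y = ⊥ := by
    have := (hUp.comap_subtype (K := H)).disjoint_of_not_dvd hY.not_dvd
    rwa [inf_eq_right.2 fun y hy => mem_comap.2 (hYU y hy)] at this
  exact hlt.ne (P.3 (hY.isPGroup_of_eq_bot hYbot) hlt.le).symm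

theorem isPNilpotent_of_dstar_of_forall_lt (hp2 : p ≠ 2) (P : Sylow p G)
    (h : IsPNilpotent p (normalizer (dstar (P : Subgroup G) : Set G))) : IsPNilpotent p G := by
  by_contra hG
  have hY := eq_bot_of_not_dvd_card ih h hG
  obtain ⟨V, hVn, hVbot, hVp⟩ := exists_normal_isPGroup ih h hG
  let s : Set (Subgroup G) := {N | N.Normal ∧ IsPGroup p N}
  let U : Subgroup G := ⨆ N ∈ s, N
  have hU : ∀ N : Subgroup G, N.Normal → IsPGroup p N → N ≤ U :=
    fun N hN hNp => le_biSup (fun N : Subgroup G => N) (show N ∈ s from ⟨hN, hNp⟩)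
  have hUp : IsPGroup p U := Sylow.biSup_of_normal s id (fun _ hN => hN.2) fun _ hN => hN.1
  have hUn : U.Normal := by
    have : ∀ N : s, (N : Subgroup G).Normal := fun N => N.2.1
    have h1 : U = ⨆ N : s, (N : Subgroup G) := iSup_subtype'
    rw [h1]
    infer_instance
  have hUbot : U ≠ ⊥ := fun he => hVbot (le_bot_iff.1 (he ▸ hU V hVn hVp))
  obtain ⟨K, hK⟩ := isPNilpotent_quotient ih h hUbot hUp hU
  have := hK.normal
  have hKm : ∃ m, ¬ p ∣ m ∧ ∀ y ∈ K.comap (QuotientGroup.mk' U), y ^ m ∈ U :=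
    ⟨_, hK.not_dvd, fun _ => pow_card_mem_of_mem_comap_mk'⟩
  have hC : centralizer (U : Set G) ≤ U :=
    centralizer_le_of_normal_complement hU hY hKm fun g => hK.pow_mem (g : G ⧸ U)
  have hcoatom : ∀ S : Sylow p G, IsCoatom (S : Subgroup G) := fun S =>
    isCoatom_sylow ih (isPNilpotent_normalizer_dstar_sylow h S) hG hUp hC
  have hKP : ¬ K.comap (QuotientGroup.mk' U) ≤ P := by
    intro hle
    have hKU := (le_inf le_rfl hle).trans (hK.comap_inf_le P.2)
    refine (hcoatom P).1 (top_le_iff.1 (le_trans (fun g _ => ?_) (hUp.le_sylow_of_normal P)))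
    have hGp : IsPGroup p (⊤ : Subgroup G) := by
      rintro ⟨g, _⟩
      obtain ⟨k, hk⟩ := hK.pow_mem (g : G ⧸ U)
      obtain ⟨l, hl⟩ := hUp ⟨g ^ p ^ k, hKU hk⟩
      refine ⟨k + l, Subtype.ext ?_⟩
      rw [pow_add, pow_mul]
      have h1 : (g ^ p ^ k) ^ p ^ l = 1 := congrArg Subtype.val hl
      exact h1
    exact hU ⊤ inferInstance hGp (mem_top g)
  have hconf : MinimalConfiguration p (P : Subgroup G) U (K.comap (QuotientGroup.mk' U)) :=
    { isPGroup := P.2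
      isCoatom := hcoatom P
      normal := hUn
      normal' := inferInstance
      le := hUp.le_sylow_of_normal P
      le_of_normal := hU
      exists_pow := hKm
      commutator_le := hK.commutator_comap_le hcoatom
      le_sup := (hcoatom P).2 _ (right_lt_sup.2 hKP)
      centralizer_le := hC }
  have := hconf.dstar_normal hp2
  rw [normalizer_eq_top_iff.2 this] at h
  exact hG (isPNilpotent_top.1 h)

end Thompson

/-- For odd `p`, if the normalizer of `dstar P` is `p`-nilpotent, where `P` is a Sylow
`p`-subgroup of `G`, then `G` is `p`-nilpotent. -/
theorem isPNilpotent_of_dstar.{u} {p : ℕ} [Fact p.Prime] (hp2 : p ≠ 2) {G : Type u} [Group G]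
    [Finite G] (P : Sylow p G)
    (h : IsPNilpotent p (normalizer (dstar (P : Subgroup G) : Set G))) : IsPNilpotent p G := by
  induction hn : Nat.card G using Nat.strong_induction_on generalizing G with
  | _ n ih =>
  subst hn
  exact isPNilpotent_of_dstar_of_forall_lt (fun H _ _ hH S hS => ih _ hH S hS rfl) hp2 P h

theorem isPNilpotent_of_isNilpotent {p : ℕ} [hp : Fact p.Prime] {G : Type*} [Group G] [Finite G]
    (h : Group.IsNilpotent G) : IsPNilpotent p G := by
  by_cases hpG : p ∣ Nat.card G
  · obtain ⟨e⟩ := ((Group.isNilpotent_of_finite_tfae (G := G)).out 0 4).1 h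
    let q : (Nat.card G).primeFactors := ⟨p, Nat.mem_primeFactors.2 ⟨hp.out, hpG, Nat.card_pos.ne'⟩⟩
    obtain ⟨P⟩ : Nonempty (Sylow p G) := inferInstance
    let f : G →* (P : Subgroup G) :=
      ((Pi.evalMonoidHom (fun P : Sylow p G => (P : Subgroup G)) P).comp
        (Pi.evalMonoidHom (fun q : (Nat.card G).primeFactors => ∀ P : Sylow q G, (P : Subgroup G))
          q)).comp e.symm.toMonoidHom
    have hf : Function.Surjective f :=
      ((Function.surjective_eval (β := fun P : Sylow p G => (P : Subgroup G)) P).comp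
        (Function.surjective_eval
          (β := fun q : (Nat.card G).primeFactors => ∀ P : Sylow q G, (P : Subgroup G)) q)).comp
        e.symm.surjective
    refine ⟨f.ker, inferInstance, fun hd => ?_, fun g => ?_⟩
    · have h1 := f.ker.card_mul_index
      rw [index_ker, MonoidHom.range_eq_top.2 hf, card_top, P.card_eq_multiplicity] at h1
      refine Nat.pow_succ_factorization_not_dvd Nat.card_pos.ne' hp.out (n := Nat.card G) ?_
      conv_rhs => rw [← h1]
      rw [pow_succ']
      exact mul_dvd_mul_right hd _
    · obtain ⟨k, hk⟩ := P.2 (f g)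
      exact ⟨k, by rw [MonoidHom.mem_ker, map_pow, hk]⟩
  · exact IsPNilpotent.of_not_dvd_card hpG

section NilpotentMaximal

variable {G : Type*} [Group G] {M : Subgroup G}

theorem normalizer_eq_of_isCoatom (hM : IsCoatom M) (hcore : M.normalCore = ⊥) {K : Subgroup G}
    (hKM : K ≤ M) (hK : K ≠ ⊥) (hMK : M ≤ normalizer (K : Set G)) :
    normalizer (K : Set G) = M := by
  refine (hM.le_iff.1 hMK).resolve_left fun htop => hK ?_
  have : K.Normal := normalizer_eq_top_iff.1 htop
  exact le_bot_iff.1 (hcore ▸ normal_le_normalCore.2 hKM)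

variable [Finite G]

theorem isPNilpotent_of_dvd_card (hM : IsCoatom M) [hnil : Group.IsNilpotent M]
    (hcore : M.normalCore = ⊥) {p : ℕ} [hp : Fact p.Prime] (hp2 : p ≠ 2) (hpM : p ∣ Nat.card M) :
    IsPNilpotent p G := by
  obtain ⟨S⟩ : Nonempty (Sylow p M) := inferInstance
  have hS : (S : Subgroup M).Normal := inferInstance
  set P := (S : Subgroup M).map M.subtype with hP
  have hPM : P ≤ M := map_subtype_le _
  have hPp : IsPGroup p P := S.2.map _
  have hPbot : P ≠ ⊥ := by
    rw [hP, Ne, map_eq_bot_iff_of_injective _ M.subtype_injective]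
    exact S.ne_bot_of_dvd_card hpM
  have hMN : M ≤ normalizer (P : Set G) := by
    rw [← normal_subgroupOf_iff_le_normalizer hPM, hP, subgroupOf,
      comap_map_eq_self_of_injective M.subtype_injective]
    exact hS
  have hNP := normalizer_eq_of_isCoatom hM hcore hPM hPbot hMN
  obtain ⟨R, hR⟩ := hPp.exists_le_sylow
  have hPR : P = R := by
    by_contra hne
    obtain ⟨x, hxR, hxP, hxN⟩ := R.2.exists_normalizer_notMem (lt_of_le_of_ne hR hne)
    rw [hNP] at hxN
    have h1 : (S : Subgroup M) ≤ (R : Subgroup G).subgroupOf M := map_le_iff_le_comap.1 hR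
    have h2 := S.3 (R.2.comap_subtype : IsPGroup p ((R : Subgroup G).subgroupOf M)) h1
    have h3 : (⟨x, hxN⟩ : M) ∈ (R : Subgroup G).comap M.subtype := hxR
    rw [h2] at h3
    exact hxP ⟨_, h3, rfl⟩
  refine isPNilpotent_of_dstar hp2 R ?_
  rw [← hPR, normalizer_eq_of_isCoatom hM hcore
    ((isQuadraticallyClosed_dstar hPp).le.trans hPM) (dstar_ne_bot hPp hPbot)
    (hMN.trans (normalizer_le_normalizer_dstar hPp))]
  exact isPNilpotent_of_isNilpotent hnil

theorem isSolvable_of_iInf_eq_bot {s : Finset ℕ} (hs : ∀ p ∈ s, p.Prime) {K : ℕ → Subgroup G}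
    (hK : ∀ p ∈ s, IsNormalComplement p (K p)) (hbot : ⨅ p ∈ s, K p = ⊥) :
    Group.IsSolvable G := by
  have := fun p : s => (hK p p.2).normal
  have hnil : ∀ p : s, Group.IsNilpotent (G ⧸ K p) := by
    intro p
    have : Fact (p : ℕ).Prime := ⟨hs p p.2⟩
    have h : IsPGroup p (G ⧸ K p) := by
      intro g
      obtain ⟨g, rfl⟩ := QuotientGroup.mk_surjective g
      obtain ⟨k, hk⟩ := (hK p p.2).pow_mem g
      exact ⟨k, by rwa [← QuotientGroup.mk_pow, QuotientGroup.eq_one_iff]⟩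
    exact h.isNilpotent
  refine Group.isSolvable_of_isSolvable_injective
    (f := MonoidHom.pi fun p : s => QuotientGroup.mk' (K p)) ?_
  rw [← MonoidHom.ker_eq_bot_iff, eq_bot_iff, ← hbot]
  intro g hg
  simp only [mem_iInf]
  intro p hp
  have := (hK p hp).normal
  exact (QuotientGroup.eq_one_iff g).1 (congrFun hg ⟨p, hp⟩)

/-- The commutator map of a fixed-point-free automorphism of a finite group is surjective. -/
theorem exists_eq_commutatorElement {S : Subgroup G} {x : G} (hx : ∀ s ∈ S, x * s * x⁻¹ ∈ S)
    (hfix : ∀ s ∈ S, Commute s x → s = 1) {y : G} (hy : y ∈ S) : ∃ s ∈ S, ⁅s, x⁆ = y := by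
  have hmem : ∀ s : S, ⁅(s : G), x⁆ ∈ S := by
    intro s
    rw [commutatorElement_def, show (s : G) * x * (s : G)⁻¹ * x⁻¹ = s * (x * (s : G)⁻¹ * x⁻¹) by
      group]
    exact mul_mem s.2 (hx _ (inv_mem s.2))
  have hinj : Function.Injective fun s : S => (⟨⁅(s : G), x⁆, hmem s⟩ : S) := by
    intro a b hab
    have h1 : (a : G) * x * (a : G)⁻¹ = b * x * (b : G)⁻¹ := by
      simpa [commutatorElement_def] using congrArg Subtype.val hab
    have h2 : Commute ((b : G)⁻¹ * a) x := by
      rw [commute_iff_eq]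
      calc (b : G)⁻¹ * a * x = (b : G)⁻¹ * (a * x * (a : G)⁻¹) * a := by group
        _ = _ := by rw [h1]; group
    exact Subtype.ext (inv_mul_eq_one.1 (hfix _ (mul_mem (inv_mem b.2) a.2) h2)).symm
  obtain ⟨s, hs⟩ := Finite.surjective_of_injective hinj ⟨y, hy⟩
  exact ⟨s, s.2, congrArg Subtype.val hs⟩

end NilpotentMaximal

section NilpotentMaximal

variable {G : Type*} [Group G] [Finite G] {M : Subgroup G}

/-- A subgroup normalized by an element `x ∈ Z(M)` without fixed points on `N` is normalized by
the complement `M` of `N`. -/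
theorem le_normalizer_of_mem_normalizer {N : Subgroup G} [N.Normal] (hNM : N ⊓ M = ⊥) {x : G}
    (hx : ∀ g, Commute g x ↔ g ∈ M) {T : Subgroup G} (hTN : T ⊔ N = ⊤) (hxT : x ∈ T) : M ≤ T := by
  intro g hg
  obtain ⟨t, ht, n, hn, htn⟩ := mem_sup_of_normal_right.1 (hTN ▸ mem_top g : g ∈ T ⊔ N)
  have hmem : ⁅t, x⁆ ∈ N ⊓ T := by
    refine ⟨?_, commutator_le_self T (commutator_mem_commutator ht hxT)⟩
    have h1 : t = g * n⁻¹ := by rw [← htn]; group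
    have h2 : g⁻¹ * x⁻¹ = x⁻¹ * g⁻¹ := ((hx g).2 hg).inv_inv.eq
    have h3 : ⁅t, x⁆ = g * (n⁻¹ * (x * n * x⁻¹)) * g⁻¹ := by
      calc ⁅t, x⁆ = g * n⁻¹ * x * n * (g⁻¹ * x⁻¹) := by rw [commutatorElement_def, h1]; group
        _ = _ := by rw [h2]; group
    rw [h3]
    exact Normal.conj_mem ‹_› _ 
      (N.mul_mem (N.inv_mem hn) (Normal.conj_mem ‹_› n hn x)) g
  obtain ⟨m, ⟨hmN, hmT⟩, hm⟩ := exists_eq_commutatorElement (S := N ⊓ T) (x := x)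
    (fun s hs => ⟨Normal.conj_mem ‹_› s hs.1 x, T.mul_mem (T.mul_mem hxT hs.2) (T.inv_mem hxT)⟩)
    (fun s hs hsx => by
      have : s ∈ N ⊓ M := ⟨hs.1, (hx s).1 hsx⟩
      rwa [hNM, mem_bot] at this) hmem
  have hc : m⁻¹ * t ∈ M := by
    rw [← hx, commute_iff_eq]
    rw [commutatorElement_def, commutatorElement_def, mul_left_inj] at hm
    calc m⁻¹ * t * x = m⁻¹ * (t * x * t⁻¹) * t := by group
      _ = _ := by rw [← hm]; group
  have hg1 : g * (m⁻¹ * t)⁻¹ ∈ N ⊓ M := by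
    refine ⟨?_, M.mul_mem hg (M.inv_mem hc)⟩
    have : g * (m⁻¹ * t)⁻¹ = t * n * t⁻¹ * m := by rw [← htn]; group
    rw [this]
    exact mul_mem (Normal.conj_mem ‹_› n hn t) hmN
  rw [hNM, mem_bot, mul_inv_eq_one] at hg1
  rw [hg1]
  exact mul_mem (inv_mem hmT) ht

theorem exists_normal_sup_eq_top (hM : IsCoatom M) {N : Subgroup G}
    [N.Normal] (hN : N ≠ ⊥) (hNM : N ⊓ M = ⊥) {x : G}
    (hx : ∀ g, Commute g x ↔ g ∈ M) :
    ∃ q : ℕ, q.Prime ∧ ∃ R : Subgroup G, R.Normal ∧ IsPGroup q R ∧ R ⊔ M = ⊤ := by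
  have hcard : Nat.card N ≠ 1 := fun he => hN (card_eq_one.1 he)
  set q := (Nat.card N).minFac
  have hq : Fact q.Prime := ⟨Nat.minFac_prime hcard⟩
  refine ⟨q, hq.out, ?_⟩
  obtain ⟨Q⟩ : Nonempty (Sylow q N) := inferInstance
  obtain ⟨t, ht, n, hn, htn⟩ := mem_sup_of_normal_right.1
    (Q.normalizer_sup_eq_top ▸ mem_top x⁻¹ :
      x⁻¹ ∈ normalizer ((Q : Subgroup N).map N.subtype : Set G) ⊔ N)
  obtain ⟨m, hm, hmn⟩ := exists_eq_commutatorElement (S := N) (x := x)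
    (fun s hs => Normal.conj_mem ‹_› s hs x)
    (fun s hs hsx => by
      have : s ∈ N ⊓ M := ⟨hs, (hx s).1 hsx⟩
      rwa [hNM, mem_bot] at this) hn
  have hxt : m * x * m⁻¹ = t⁻¹ := by
    rw [commutatorElement_def] at hmn
    rw [← mul_eq_one_iff_eq_inv', ← mul_left_inj x⁻¹, one_mul, mul_assoc, hmn, htn]
  set R : Sylow q N := (⟨m, hm⟩ : N)⁻¹ • Q with hR
  set R' := (R : Subgroup N).map N.subtype with hR'
  have hconj : R' = ((Q : Subgroup N).map N.subtype).map (MulAut.conj m⁻¹).toMonoidHom := by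
    rw [map_map]
    change ((Q : Subgroup N).map (MulAut.conj (⟨m, hm⟩ : N)⁻¹).toMonoidHom).map N.subtype = _
    rw [map_map]
    congr 1
  have hxR : x ∈ normalizer (R' : Set G) := by
    rw [mem_normalizer_iff_map_conj_eq, hconj]
    have ht' := mem_normalizer_iff_map_conj_eq.1 (hxt ▸ inv_mem ht :
      m * x * m⁻¹ ∈ normalizer ((Q : Subgroup N).map N.subtype : Set G))
    conv_rhs => rw [← ht']
    simp only [map_map]
    refine congrArg (fun φ : N →* G => map φ (Q : Subgroup N)) ?_
    ext g
    simp [mul_assoc]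
  have hR'N : R' ≤ N := map_subtype_le _
  have hMR := le_normalizer_of_mem_normalizer hNM hx R.normalizer_sup_eq_top hxR
  have hR'M : ¬ R' ≤ M := by
    intro hle
    have hbot := le_bot_iff.1 ((le_inf hR'N hle).trans hNM.le)
    rw [hR', map_eq_bot_iff_of_injective _ N.subtype_injective] at hbot
    exact R.ne_bot_of_dvd_card (Nat.minFac_dvd _) hbot
  refine ⟨R', ?_, R.2.map _, (hM.2 _ (right_lt_sup.2 hR'M))⟩
  rw [← normalizer_eq_top_iff]
  exact (hM.le_iff.1 hMR).resolve_right fun he => hR'M (le_normalizer.trans he.le)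

theorem isSolvable_of_normalCore_eq_bot [hnil : Group.IsNilpotent M] (hM : IsCoatom M)
    (hcore : M.normalCore = ⊥) (hodd : ¬ 2 ∣ Nat.card M) : Group.IsSolvable G := by
  by_cases hbot : M = ⊥
  · by_cases htriv : ∀ g : G, g = 1
    · have : Subsingleton G := ⟨fun a b => (htriv a).trans (htriv b).symm⟩
      infer_instance
    · push Not at htriv
      obtain ⟨g, hg⟩ := htriv
      have htop : zpowers g = ⊤ :=
        hM.2 _ (by rw [hbot, bot_lt_iff_ne_bot, Ne, zpowers_eq_bot]; exact hg)
      have : IsCyclic G := ⟨g, fun y => mem_zpowers_iff.1 (htop ▸ mem_top y : y ∈ zpowers g)⟩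
      exact Group.isSolvable_of_comm IsCyclic.isMulCommutative.is_comm.comm
  have hK : ∀ p : ℕ, ∃ K : Subgroup G, p ∈ (Nat.card M).primeFactors → IsNormalComplement p K := by
    intro p
    by_cases hp : p ∈ (Nat.card M).primeFactors
    · have : Fact p.Prime := ⟨Nat.prime_of_mem_primeFactors hp⟩
      have hpM := Nat.dvd_of_mem_primeFactors hp
      obtain ⟨K, hK⟩ := isPNilpotent_of_dvd_card hM hcore (fun h2 => hodd (h2 ▸ hpM)) hpM
      exact ⟨K, fun _ => hK⟩
    · exact ⟨⊤, fun h => absurd h hp⟩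
  choose K hK using hK
  set N := ⨅ p ∈ (Nat.card M).primeFactors, K p with hN
  by_cases hNbot : N = ⊥
  · exact isSolvable_of_iInf_eq_bot (fun p => Nat.prime_of_mem_primeFactors) hK hNbot
  have hNn : N.Normal :=
    normal_iInf_normal fun p => normal_iInf_normal fun hp => (hK p hp).normal
  have hNM : N ⊓ M = ⊥ := by
    rw [← card_eq_one]
    by_contra hne
    obtain ⟨p, hp, hpd⟩ := Nat.exists_prime_and_dvd hne
    have hpM : p ∈ (Nat.card M).primeFactors :=
      Nat.mem_primeFactors.2 ⟨hp, hpd.trans (card_dvd_of_le inf_le_right), Nat.card_pos.ne'⟩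
    exact (hK p hpM).not_dvd
      (hpd.trans (card_dvd_of_le (inf_le_left.trans (iInf₂_le p hpM))))
  have := M.nontrivial_iff_ne_bot.2 hbot
  obtain ⟨⟨x, hxZ⟩, hx1⟩ := ne_bot_iff_exists_ne_one.1 (Group.IsNilpotent.center_ne_bot M)
  have hMC : M ≤ centralizer {(x : G)} := fun g hg =>
    mem_centralizer_singleton_iff.2 (congrArg Subtype.val (mem_center_iff.1 hxZ ⟨g, hg⟩))
  have hC : centralizer {(x : G)} = M := by
    refine (hM.le_iff.1 hMC).resolve_left fun htop => hx1 ?_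
    have hxG : (x : G) ∈ center G := mem_center_iff.2 fun g =>
      mem_centralizer_singleton_iff.1 (htop ▸ mem_top g)
    have : (zpowers (x : G)).Normal := ⟨fun n hn g => by
      rwa [mem_center_iff.1 (zpowers_le.2 hxG hn), mul_inv_cancel_right]⟩
    have hle : zpowers (x : G) ≤ M.normalCore := normal_le_normalCore.2 (zpowers_le.2 x.2)
    rw [hcore, le_bot_iff, zpowers_eq_bot] at hle
    exact Subtype.ext (Subtype.ext hle)
  have hx : ∀ g : G, Commute g x ↔ g ∈ M := fun g =>
    ⟨fun h => hC.le (mem_centralizer_singleton_iff.2 h.eq),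
      fun h => mem_centralizer_singleton_iff.1 (hMC h)⟩
  obtain ⟨q, hq, R, hRn, hRq, hRM⟩ := exists_normal_sup_eq_top hM hNbot hNM hx
  have : Fact q.Prime := ⟨hq⟩
  have := hRq.isNilpotent
  have hsurj : Function.Surjective ((QuotientGroup.mk' R).comp M.subtype) := by
    intro g
    obtain ⟨g, rfl⟩ := QuotientGroup.mk'_surjective R g
    obtain ⟨r, hr, m, hm, rfl⟩ := mem_sup_of_normal_left.1 (hRM ▸ mem_top g : g ∈ R ⊔ M)
    refine ⟨⟨m, hm⟩, ?_⟩
    rw [map_mul, QuotientGroup.mk'_apply, (QuotientGroup.eq_one_iff r).2 hr, one_mul]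
    rfl
  exact (Group.isSolvable_iff_subgroup_quotient R).2
    ⟨inferInstance, Group.isSolvable_of_surjective hsurj⟩

theorem isSolvable_of_isCoatom_of_isNilpotent {G : Type*} [Group G] [Finite G] {M : Subgroup G}
    (hM : IsCoatom M) (hnil : Group.IsNilpotent M) (hodd : ¬ 2 ∣ Nat.card M) :
    Group.IsSolvable G := by
  set f := QuotientGroup.mk' M.normalCore with hf
  have hfs : Function.Surjective f := QuotientGroup.mk'_surjective _
  have hker : f.ker = M.normalCore := QuotientGroup.ker_mk' _
  have hcomap : (M.map f).comap f = M := by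
    rw [comap_map_eq, hker, sup_eq_left.2 M.normalCore_le]
  have hMf : IsCoatom (M.map f) := by
    refine ⟨fun he => hM.1 ?_, fun H hH => ?_⟩
    · rw [← hcomap, he, comap_top]
    · have : M < H.comap f := by
        refine hcomap.symm.trans_lt ?_
        exact (comap_lt_comap_of_surjective hfs).2 hH
      rw [← map_comap_eq_self_of_surjective hfs H, hM.2 _ this, map_top_of_surjective f hfs]
  have hcore : (M.map f).normalCore = ⊥ := by
    have hle : (M.map f).normalCore.comap f ≤ M.normalCore :=
      normal_le_normalCore.2 ((comap_mono (normalCore_le _)).trans hcomap.le)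
    rw [← map_comap_eq_self_of_surjective hfs (M.map f).normalCore, Subgroup.map_eq_bot_iff, hker]
    exact hle
  have hnil' : Group.IsNilpotent (M.map f) :=
    Group.nilpotent_of_surjective (f.subgroupMap M) (f.subgroupMap_surjective M)
  have := isSolvable_of_normalCore_eq_bot hMf hcore fun hd => hodd (hd.trans (card_map_dvd M f))
  have hN : Group.IsSolvable M.normalCore :=
    Group.isSolvable_of_isSolvable_injective (inclusion_injective M.normalCore_le)
  exact (Group.isSolvable_iff_subgroup_quotient M.normalCore).2 ⟨hN, this⟩

end NilpotentMaximal

theorem stmt3 {G : Type*} [Group G] [Fintype G] (hG : ¬ IsSolvable G)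
    (M : Subgroup G) (hM : IsCoatom M) (hnil : Group.IsNilpotent ↥M) :
    Even (Nat.card ↥M) := by
  by_contra h
  exact hG (isSolvable_of_isCoatom_of_isNilpotent hM hnil fun hd => h (even_iff_two_dvd.2 hd))
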